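/- arXiv:2605.17794 — 11 statements merged into one kernel-verified Lean document; each statement's English description precedes it below -/
import Mathlib

section
/- Let f, g, Ω : ℝ → ℝ be differentiable functions with Ω' = f·g, and suppose f, g, Ω are nowhere zero. Set f^{[1]} := Ω/g (so that f^{[1]} = T_I[g](f) with ∂^{-1}(gf) chosen to be Ω). Then for every x ∈ ℝ, f^{[1]}(x) · d/dx[ (f^{[1]})^{-1} · g^{-1} ](x) = −f(x)/Ω(x); that is, T_D[f^{[1]}](g^{-1}) = ((T_D[f]^{-1})^*(g))^{-1}, where (T_D[f]^{-1})^*(g) = −Ω/f. -/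
/-- Identity (3.6): `T_D[f^{[1]}](g⁻¹) = ((T_D[f]⁻¹)^*(g))⁻¹`, where
`f^{[1]} = T_I[g](f) = Ω/g` and `(T_D[f]⁻¹)^*(g) = −Ω/f`, with `Ω' = f·g`. -/
theorem stmt_0 (f g Ω : ℝ → ℝ)
    (hf : Differentiable ℝ f) (hg : Differentiable ℝ g) (hΩ : Differentiable ℝ Ω)
    (hΩ' : ∀ x, deriv Ω x = f x * g x)
    (hf0 : ∀ x, f x ≠ 0) (hg0 : ∀ x, g x ≠ 0) (hΩ0 : ∀ x, Ω x ≠ 0)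
    (f1 : ℝ → ℝ) (hf1 : ∀ x, f1 x = Ω x / g x) :
    ∀ x : ℝ, f1 x * deriv (fun y => (f1 y)⁻¹ * (g y)⁻¹) x = -(f x / Ω x) := by
  intro x
  have h : (fun y => (f1 y)⁻¹ * (g y)⁻¹) = fun y => (Ω y)⁻¹ := by
    funext y
    have h1 := hg0 y
    have h2 := hΩ0 y
    rw [hf1]
    field_simp
  have hd : HasDerivAt (fun y => (Ω y)⁻¹) (-(f x * g x) / Ω x ^ 2) x := by
    rw [← hΩ' x]
    exact (hΩ x).hasDerivAt.fun_inv (hΩ0 x)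
  have h1 := hg0 x
  have h2 := hΩ0 x
  rw [h, hd.deriv, hf1]
  field_simp
end

section
/- Let g₁, g₂ : ℝ → ℝ be differentiable with g₁, g₂ nowhere zero, and suppose the functions g₂^{[1]} := −g₁·(g₂/g₁)' and g₂·(g₁/g₂)' are nowhere zero. Then for every x ∈ ℝ, (g₂^{[1]}(x))^{-1} · ( −g₂(x)/g₁(x) ) = ( −g₂(x)·(g₁/g₂)'(x) )^{-1}; that is, T_I[g₂^{[1]}](g₁^{-1}) = ((T_I[g₂]^{-1})^*(g₁))^{-1}, where in the left-hand side the antiderivative ∂^{-1}(g₂^{[1]}·g₁^{-1}) is chosen to be −g₂/g₁, and (T_I[g₂]^{-1})^*(g₁) = −g₂·(g₁/g₂)'. -/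
/-- Identity (3.9): `T_I[g₂^{[1]}](g₁⁻¹) = ((T_I[g₂]⁻¹)^*(g₁))⁻¹`, with
`g₂^{[1]} = −g₁·(g₂/g₁)'`, `(T_I[g₂]⁻¹)^*(g₁) = −g₂·(g₁/g₂)'`, and the
antiderivative `∂⁻¹(g₂^{[1]}·g₁⁻¹)` chosen to be `−g₂/g₁`. -/
theorem stmt_3 (g₁ g₂ : ℝ → ℝ)
    (h1 : Differentiable ℝ g₁) (h2 : Differentiable ℝ g₂)
    (h10 : ∀ x, g₁ x ≠ 0) (h20 : ∀ x, g₂ x ≠ 0)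
    (g21 : ℝ → ℝ) (hg21 : ∀ x, g21 x = -(g₁ x) * deriv (fun y => g₂ y / g₁ y) x)
    (hg210 : ∀ x, g21 x ≠ 0)
    (h120 : ∀ x, g₂ x * deriv (fun y => g₁ y / g₂ y) x ≠ 0) :
    ∀ x : ℝ, (g21 x)⁻¹ * (-(g₂ x) / g₁ x) = (-(g₂ x) * deriv (fun y => g₁ y / g₂ y) x)⁻¹ := by
  intro x
  have hd21 := deriv_fun_div (h2 x) (h1 x) (h10 x)
  have hd12 := deriv_fun_div (h1 x) (h2 x) (h20 x)
  have ha := h10 x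
  have hb := h20 x
  have hg := hg210 x
  rw [hg21, hd21] at hg
  have hW : deriv g₂ x * g₁ x - g₂ x * deriv g₁ x ≠ 0 := fun h => hg (by simp [h])
  have key : -(g₂ x) * ((deriv g₁ x * g₂ x - g₁ x * deriv g₂ x) / g₂ x ^ 2) =
      (deriv g₂ x * g₁ x - g₂ x * deriv g₁ x) / g₂ x := by
    field_simp
    ring
  rw [hg21, hd21, hd12, key]
  field_simp
end

section
/- Let q, u, Ω, A : ℝ → ℝ be differentiable functions with Ω' = q², A' = q·u, and suppose q and Ω are nowhere zero. Set q^{[1]} := Ω/q. Then for every x ∈ ℝ, q^{[1]}(x) · d/dx[ (A/q) · (q^{[1]})^{-1} ](x) = u(x) − q(x)·A(x)/Ω(x); that is, the fundamental CKP Darboux operator T[q] = 1 − Ω^{-1} q ∂^{-1} q factorizes as T[q] = T_D[q^{[1]}] ∘ T_I[q]: applying T_D[q^{[1]}] to T_I[q](u) = A/q yields T[q](u) = u − (q/Ω)·A. -/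
/-- Factorization `T[q] = T_D[q^{[1]}] ∘ T_I[q]` of the fundamental CKP Darboux
operator: with `q^{[1]} = Ω/q` (`Ω' = q²`) and `A' = q·u`, applying `T_D[q^{[1]}]`
to `T_I[q](u) = A/q` yields `T[q](u) = u − (q/Ω)·A`. -/
theorem stmt_4 (q u Ω A : ℝ → ℝ)
    (hq : Differentiable ℝ q) (hu : Differentiable ℝ u)
    (hΩ : Differentiable ℝ Ω) (hA : Differentiable ℝ A)
    (hΩ' : ∀ x, deriv Ω x = (q x) ^ 2)
    (hA' : ∀ x, deriv A x = q x * u x)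
    (hq0 : ∀ x, q x ≠ 0) (hΩ0 : ∀ x, Ω x ≠ 0)
    (q1 : ℝ → ℝ) (hq1 : ∀ x, q1 x = Ω x / q x) :
    ∀ x : ℝ, q1 x * deriv (fun y => (A y / q y) * (q1 y)⁻¹) x
      = u x - q x * A x / Ω x := by
  intro x
  have hfun : (fun y => (A y / q y) * (q1 y)⁻¹) = A / Ω := by
    funext y
    have := hq0 y
    have := hΩ0 y
    simp only [hq1, Pi.div_apply]
    field_simp
  have hqx := hq0 x
  have hΩx := hΩ0 x
  rw [hfun, deriv_div (hA x) (hΩ x) hΩx, hA', hΩ', hq1]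
  field_simp
end

section
/- Let q, u, Ω, A : ℝ → ℝ be differentiable functions with Ω' = q², A' = q·u, and suppose Ω is nowhere zero. Set v := u − (q/Ω)·A (i.e. v = T[q](u)). Then: (i) the function A/Ω is an antiderivative of q·v/Ω, i.e. (A/Ω)' = (q·v)/Ω; and (ii) consequently T[q]^*(v) := v + q·(A/Ω) = u. In other words, the fundamental CKP Darboux operator T[q] = 1 − Ω^{-1} q ∂^{-1} q satisfies T[q]^* T[q] = 1 at the level of functions, with the antiderivative in T[q]^* = 1 + q ∂^{-1} (q Ω^{-1} ·) chosen as A/Ω. -/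
/-- `T[q]^* T[q] = 1` for the fundamental CKP Darboux operator
`T[q] = 1 − Ω⁻¹ q ∂⁻¹ q` (`Ω' = q²`, `A' = q·u`): with `v = T[q](u) = u − (q/Ω)·A`,
(i) `A/Ω` is an antiderivative of `q·v/Ω`, and (ii) `T[q]^*(v) = v + q·(A/Ω) = u`. -/
theorem stmt_5 (q u Ω A : ℝ → ℝ)
    (hq : Differentiable ℝ q) (hu : Differentiable ℝ u)
    (hΩ : Differentiable ℝ Ω) (hA : Differentiable ℝ A)
    (hΩ' : ∀ x, deriv Ω x = (q x) ^ 2)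
    (hA' : ∀ x, deriv A x = q x * u x)
    (hΩ0 : ∀ x, Ω x ≠ 0)
    (v : ℝ → ℝ) (hv : ∀ x, v x = u x - (q x / Ω x) * A x) :
    (∀ x : ℝ, deriv (fun y => A y / Ω y) x = q x * v x / Ω x) ∧
    (∀ x : ℝ, v x + q x * (A x / Ω x) = u x) := by
  refine ⟨fun x => ?_, fun x => ?_⟩
  · have hx := hΩ0 x
    rw [deriv_fun_div (hA x) (hΩ x) hx, hΩ', hA', hv]
    field_simp
  · rw [hv]
    ring
end

section
/- Let f₁, f₂, u : ℝ → ℝ be twice differentiable functions, and suppose f₁, f₂, T_D[f₂](f₁) and T_D[f₁](f₂) are nowhere zero. Then the two-step elementary Darboux transformations commute: for every x ∈ ℝ, T_D[ T_D[f₂](f₁) ]( T_D[f₂](u) )(x) = T_D[ T_D[f₁](f₂) ]( T_D[f₁](u) )(x). Equivalently, T_D[f₁^{[1]}] ∘ T_D[f₂] = T_D[f₂^{[1]}] ∘ T_D[f₁] as operators on twice differentiable functions, where f_i^{[1]} = T_D[f_{3−i}](f_i). -/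
/-- The elementary Darboux operator `T_D[h](v) = h·(v/h)' = v' − (h'/h)·v`. -/
noncomputable def TD (h v : ℝ → ℝ) : ℝ → ℝ := fun x => deriv v x - deriv h x / h x * v x

theorem deriv_TD {h v : ℝ → ℝ} (hh : Differentiable ℝ h) (hh' : Differentiable ℝ (deriv h))
    (hv : Differentiable ℝ v) (hv' : Differentiable ℝ (deriv v)) {x : ℝ} (h0 : h x ≠ 0) :
    deriv (TD h v) x = deriv (deriv v) x -
      ((deriv (deriv h) x * h x - deriv h x * deriv h x) / h x ^ 2 * v x +
        deriv h x / h x * deriv v x) :=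
  ((hv' x).hasDerivAt.sub
    (((hh' x).hasDerivAt.div (hh x).hasDerivAt h0).mul (hv x).hasDerivAt)).deriv

theorem TD_eq_wronskian_div {h v : ℝ → ℝ} {x : ℝ} (h0 : h x ≠ 0) :
    TD h v x = (deriv v x * h x - v x * deriv h x) / h x := by
  unfold TD
  field_simp

/-- Commutation of elementary Darboux transformations:
`T_D[f₁^{[1]}] ∘ T_D[f₂] = T_D[f₂^{[1]}] ∘ T_D[f₁]` with `f_i^{[1]} = T_D[f_{3−i}](f_i)`. -/
theorem stmt_6 (f₁ f₂ u : ℝ → ℝ)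
    (hf₁ : Differentiable ℝ f₁) (hf₁' : Differentiable ℝ (deriv f₁))
    (hf₂ : Differentiable ℝ f₂) (hf₂' : Differentiable ℝ (deriv f₂))
    (hu : Differentiable ℝ u) (hu' : Differentiable ℝ (deriv u))
    (h10 : ∀ x, f₁ x ≠ 0) (h20 : ∀ x, f₂ x ≠ 0)
    (h30 : ∀ x, TD f₂ f₁ x ≠ 0) (h40 : ∀ x, TD f₁ f₂ x ≠ 0) :
    ∀ x : ℝ, TD (TD f₂ f₁) (TD f₂ u) x = TD (TD f₁ f₂) (TD f₁ u) x := by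
  intro x
  have h1 := h10 x
  have h2 := h20 x
  have hW : deriv f₁ x * f₂ x - f₁ x * deriv f₂ x ≠ 0 := by
    intro hW
    exact h30 x (by rw [TD_eq_wronskian_div h2, hW, zero_div])
  have hW' : TD f₁ f₂ x = -(deriv f₁ x * f₂ x - f₁ x * deriv f₂ x) / f₁ x := by
    rw [TD_eq_wronskian_div h1]
    ring
  rw [TD.eq_def (TD f₂ f₁), TD.eq_def (TD f₁ f₂)]
  rw [deriv_TD hf₂ hf₂' hu hu' h2, deriv_TD hf₂ hf₂' hf₁ hf₁' h2,
    deriv_TD hf₁ hf₁' hu hu' h1, deriv_TD hf₁ hf₁' hf₂ hf₂' h1, hW',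
    TD_eq_wronskian_div h2, TD_eq_wronskian_div h2, TD_eq_wronskian_div h1]
  generalize hw : deriv f₁ x * f₂ x - f₁ x * deriv f₂ x = w at hW ⊢
  field_simp
  rw [← hw]
  ring
end

section
/- Let f, g, u, Ω, B : ℝ → ℝ be differentiable functions with Ω' = f·g and B' = g·u, and suppose f, g, Ω are nowhere zero. Set g^{[1]} := −Ω/f and f^{[1]} := Ω/g. Then: (i) the function B − Ω·u/f is an antiderivative of g^{[1]} · T_D[f](u), i.e. d/dx(B − Ωu/f) = (−Ω/f)·(u' − (f'/f)u) (assuming additionally that u and f are differentiable so that T_D[f](u) is defined); and (ii) (−f/Ω)·(B − Ωu/f) = f^{[1]} · d/dx[ (B/g)·(f^{[1]})^{-1} ], i.e. T_I[g^{[1]}]( T_D[f](u) ) = T_D[f^{[1]}]( T_I[g](u) ), where T_I[g](u) = B/g and the antiderivative in T_I[g^{[1]}] is chosen to be B − Ωu/f. -/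
/-- Commutation relation `T_I[g^{[1]}] T_D[f] = T_D[f^{[1]}] T_I[g]`, with
`g^{[1]} = −Ω/f`, `f^{[1]} = Ω/g` (`Ω' = f·g`, `B' = g·u`):
(i) `B − Ωu/f` is an antiderivative of `g^{[1]}·T_D[f](u)`;
(ii) `(−f/Ω)·(B − Ωu/f) = T_D[f^{[1]}](T_I[g](u))` with `T_I[g](u) = B/g`. -/
theorem stmt_7 (f g u Ω B : ℝ → ℝ)
    (hf : Differentiable ℝ f) (hg : Differentiable ℝ g) (hu : Differentiable ℝ u)
    (hΩ : Differentiable ℝ Ω) (hB : Differentiable ℝ B)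
    (hΩ' : ∀ x, deriv Ω x = f x * g x)
    (hB' : ∀ x, deriv B x = g x * u x)
    (hf0 : ∀ x, f x ≠ 0) (hg0 : ∀ x, g x ≠ 0) (hΩ0 : ∀ x, Ω x ≠ 0)
    (g1 f1 : ℝ → ℝ)
    (hg1 : ∀ x, g1 x = -(Ω x) / f x) (hf1 : ∀ x, f1 x = Ω x / g x) :
    (∀ x : ℝ, deriv (fun y => B y - Ω y * u y / f y) x
        = g1 x * (deriv u x - deriv f x / f x * u x)) ∧
    (∀ x : ℝ, (-(f x) / Ω x) * (B x - Ω x * u x / f x)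
        = f1 x * deriv (fun y => (B y / g y) * (f1 y)⁻¹) x) := by
  have hΩd (x : ℝ) : HasDerivAt Ω (f x * g x) x := hΩ' x ▸ (hΩ x).hasDerivAt
  have hBd (x : ℝ) : HasDerivAt B (g x * u x) x := hB' x ▸ (hB x).hasDerivAt
  refine ⟨fun x => ?_, fun x => ?_⟩
  · have hf0x := hf0 x
    have h : HasDerivAt (fun y => B y - Ω y * u y / f y) _ x :=
      (hBd x).sub (((hΩd x).mul (hu x).hasDerivAt).div (hf x).hasDerivAt hf0x)
    rw [h.deriv, hg1 x]
    simp only [Pi.mul_apply]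
    field_simp
    ring
  · have hf0x := hf0 x
    have hg0x := hg0 x
    have hΩ0x := hΩ0 x
    have heq : (fun y => (B y / g y) * (f1 y)⁻¹) = fun y => B y / Ω y := by
      funext y
      have hg0y := hg0 y
      have hΩ0y := hΩ0 y
      rw [hf1 y]
      field_simp
    have h : HasDerivAt (fun y => B y / Ω y) _ x := (hBd x).div (hΩd x) hΩ0x
    rw [heq, h.deriv, hf1 x]
    field_simp
    ring
end

section
/- Let f, Ω : ℝ² → ℝ be smooth functions of (x,t) such that ∂f/∂t = ∂³f/∂x³, ∂Ω/∂x = f², ∂Ω/∂t = 2f·∂²f/∂x² − (∂f/∂x)², and Ω is nowhere zero. Define q₁ := ∂f/∂x − f³/(2Ω) and q₂ := f/Ω. Then q₁ and q₂ satisfy the (1,1)-constrained CKP t₃-flow system: ∂q₁/∂t = ∂³q₁/∂x³ + 9q₁q₂·∂q₁/∂x + 3q₁²·∂q₂/∂x and ∂q₂/∂t = ∂³q₂/∂x³ + 9q₁q₂·∂q₂/∂x + 3q₂²·∂q₁/∂x. -/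
theorem iteratedDeriv_three_eq_of_hasDerivAt {u u₁ u₂ u₃ : ℝ → ℝ}
    (h₁ : ∀ y, HasDerivAt u (u₁ y) y) (h₂ : ∀ y, HasDerivAt u₁ (u₂ y) y)
    (h₃ : ∀ y, HasDerivAt u₂ (u₃ y) y) : iteratedDeriv 3 u = u₃ := by
  rw [iteratedDeriv_succ', iteratedDeriv_succ', iteratedDeriv_one,
    funext fun y => (h₁ y).deriv, funext fun y => (h₂ y).deriv, funext fun y => (h₃ y).deriv]

theorem ContDiff.hasDerivAt_iteratedDeriv {a : ℝ → ℝ} (ha : ContDiff ℝ (⊤ : ℕ∞) a) (n : ℕ)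
    (y : ℝ) : HasDerivAt (iteratedDeriv n a) (iteratedDeriv (n + 1) a y) y := by
  rw [iteratedDeriv_succ]
  exact ((ha.differentiable_iteratedDeriv n (by exact_mod_cast ENat.natCast_lt_top n)) y).hasDerivAt

/-- Symmetry of the mixed partial derivatives of a `C²` function of two real variables. -/
theorem hasDerivAt_deriv_comm {f : ℝ → ℝ → ℝ} (hf : ContDiff ℝ 2 (fun p : ℝ × ℝ => f p.1 p.2))
    (x t : ℝ) :
    HasDerivAt (fun s => deriv (fun y => f y s) x)
      (deriv (fun y => deriv (fun s => f y s) t) x) t := by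
  set F : ℝ × ℝ → ℝ := fun p => f p.1 p.2
  have hF : Differentiable ℝ F := hf.differentiable (by norm_num)
  have hF' : Differentiable ℝ (fderiv ℝ F) :=
    (hf.fderiv_right (m := 1) (by norm_num)).differentiable (by norm_num)
  have line₁ (y s : ℝ) : HasDerivAt (fun y => (y, s)) ((1 : ℝ), (0 : ℝ)) y :=
    (hasDerivAt_id y).prodMk (hasDerivAt_const y s)
  have line₂ (y s : ℝ) : HasDerivAt (fun s => (y, s)) ((0 : ℝ), (1 : ℝ)) s :=
    (hasDerivAt_const s y).prodMk (hasDerivAt_id s)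
  have partial₁ (y s : ℝ) : deriv (fun y => f y s) y = fderiv ℝ F (y, s) (1, 0) :=
    HasDerivAt.deriv (f := fun y => F (y, s))
      ((hF (y, s)).hasFDerivAt.comp_hasDerivAt_of_eq y (line₁ y s) rfl)
  have partial₂ (y s : ℝ) : deriv (fun s => f y s) s = fderiv ℝ F (y, s) (0, 1) :=
    HasDerivAt.deriv (f := fun s => F (y, s))
      ((hF (y, s)).hasFDerivAt.comp_hasDerivAt_of_eq s (line₂ y s) rfl)
  have along₁ : HasDerivAt (fun y => fderiv ℝ F (y, t))
      (fderiv ℝ (fderiv ℝ F) (x, t) (1, 0)) x :=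
    (hF' (x, t)).hasFDerivAt.comp_hasDerivAt_of_eq x (line₁ x t) rfl
  have along₂ : HasDerivAt (fun s => fderiv ℝ F (x, s))
      (fderiv ℝ (fderiv ℝ F) (x, t) (0, 1)) t :=
    (hF' (x, t)).hasFDerivAt.comp_hasDerivAt_of_eq t (line₂ x t) rfl
  have mixed₁ : HasDerivAt (fun y => fderiv ℝ F (y, t) (0, 1))
      (fderiv ℝ (fderiv ℝ F) (x, t) (1, 0) (0, 1)) x := by
    simpa using along₁.clm_apply (hasDerivAt_const x ((0 : ℝ), (1 : ℝ)))
  have mixed₂ : HasDerivAt (fun s => fderiv ℝ F (x, s) (1, 0))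
      (fderiv ℝ (fderiv ℝ F) (x, t) (0, 1) (1, 0)) t := by
    simpa using along₂.clm_apply (hasDerivAt_const t ((1 : ℝ), (0 : ℝ)))
  have symm := second_derivative_symmetric (fun p => (hF p).hasFDerivAt)
    (hF' (x, t)).hasFDerivAt (0, 1) (1, 0)
  simp only [partial₁, partial₂]
  rw [mixed₁.deriv, ← symm]
  exact mixed₂


/-- The M = 1 instance of Theorem 3.2 for the t₃-flow: if `f_t = f_xxx`,
`Ω_x = f²`, `Ω_t = 2f·f_xx − f_x²`, `Ω ≠ 0`, then `q₁ = f_x − f³/(2Ω)` and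
`q₂ = f/Ω` solve the (1,1)-constrained CKP t₃-flow system. -/
theorem stmt_8 (f Ω : ℝ → ℝ → ℝ)
    (hf : ContDiff ℝ (⊤ : ℕ∞) (fun p : ℝ × ℝ => f p.1 p.2))
    (hΩ : ContDiff ℝ (⊤ : ℕ∞) (fun p : ℝ × ℝ => Ω p.1 p.2))
    (hft : ∀ x t, deriv (fun s => f x s) t = iteratedDeriv 3 (fun y => f y t) x)
    (hΩx : ∀ x t, deriv (fun y => Ω y t) x = (f x t) ^ 2)
    (hΩt : ∀ x t, deriv (fun s => Ω x s) t
      = 2 * f x t * iteratedDeriv 2 (fun y => f y t) x - (deriv (fun y => f y t) x) ^ 2)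
    (hΩ0 : ∀ x t, Ω x t ≠ 0)
    (q₁ q₂ : ℝ → ℝ → ℝ)
    (hq₁ : ∀ x t, q₁ x t = deriv (fun y => f y t) x - (f x t) ^ 3 / (2 * Ω x t))
    (hq₂ : ∀ x t, q₂ x t = f x t / Ω x t) :
    ∀ x t : ℝ,
      deriv (fun s => q₁ x s) t
        = iteratedDeriv 3 (fun y => q₁ y t) x
          + 9 * q₁ x t * q₂ x t * deriv (fun y => q₁ y t) x
          + 3 * (q₁ x t) ^ 2 * deriv (fun y => q₂ y t) x ∧
      deriv (fun s => q₂ x s) t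
        = iteratedDeriv 3 (fun y => q₂ y t) x
          + 9 * q₁ x t * q₂ x t * deriv (fun y => q₂ y t) x
          + 3 * (q₂ x t) ^ 2 * deriv (fun y => q₁ y t) x := by
  intro x t
  have hfx : ContDiff ℝ (⊤ : ℕ∞) (fun y => f y t) := hf.comp (contDiff_id.prodMk contDiff_const)
  have hΩx' : ContDiff ℝ (⊤ : ℕ∞) (fun y => Ω y t) := hΩ.comp (contDiff_id.prodMk contDiff_const)
  have hfs : ContDiff ℝ (⊤ : ℕ∞) (fun s => f x s) := hf.comp (contDiff_const.prodMk contDiff_id)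
  have hΩs : ContDiff ℝ (⊤ : ℕ∞) (fun s => Ω x s) := hΩ.comp (contDiff_const.prodMk contDiff_id)
  have hd₁ : HasDerivAt (fun s => deriv (fun y => f y s) x)
      (iteratedDeriv 4 (fun y => f y t) x) t := by
    have h := hasDerivAt_deriv_comm (contDiff_infty.mp hf 2) x t
    simp only [hft] at h
    rwa [iteratedDeriv_succ]
  have hd : HasDerivAt (fun s => f x s) (iteratedDeriv 3 (fun y => f y t) x) t :=
    hft x t ▸ (hfs.differentiable (by simp) t).hasDerivAt
  have hw : HasDerivAt (fun s => Ω x s) (2 * f x t * iteratedDeriv 2 (fun y => f y t) x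
      - (deriv (fun y => f y t) x) ^ 2) t :=
    hΩt x t ▸ (hΩs.differentiable (by simp) t).hasDerivAt
  have hW (y : ℝ) : HasDerivAt (fun y => Ω y t) ((f y t) ^ 2) y :=
    hΩx y t ▸ (hΩx'.differentiable (by simp) y).hasDerivAt
  have hA := hfx.hasDerivAt_iteratedDeriv
  have hA₀ := hA 0
  have hA₁ := hA 1
  have hA₂ := hA 2
  have hA₃ := hA 3
  obtain rfl : q₁ = fun x t => deriv (fun y => f y t) x - (f x t) ^ 3 / (2 * Ω x t) :=
    funext fun x => funext (hq₁ x)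
  obtain rfl : q₂ = fun x t => f x t / Ω x t := funext fun x => funext (hq₂ x)
  have hq₁t := hd₁.sub ((hd.pow 3).div (hw.const_mul 2) (mul_ne_zero two_ne_zero (hΩ0 x t)))
  have hq₂t := hd.div hw (hΩ0 x t)
  simp only [iteratedDeriv_zero, iteratedDeriv_one, zero_add, Nat.reduceAdd] at hA₀ hA₁ hA₂ hA₃
  clear hA hq₁ hq₂ hd₁ hd hw hft hΩx hΩt hΩx' hfs hΩs hfx
  rw [show deriv (fun s => deriv (fun y => f y s) x - (f x s) ^ 3 / (2 * Ω x s)) t = _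
    from hq₁t.deriv, show deriv (fun s => f x s / Ω x s) t = _ from hq₂t.deriv]
  clear hq₁t hq₂t
  beta_reduce
  set a : ℝ → ℝ := fun y => f y t
  set w : ℝ → ℝ := fun y => Ω y t
  set a₁ := deriv a
  set a₂ := iteratedDeriv 2 a
  set a₃ := iteratedDeriv 3 a
  set a₄ := iteratedDeriv 4 a
  have hw0 (y : ℝ) : w y ≠ 0 := hΩ0 y t
  change ∀ y, HasDerivAt w (a y ^ 2) y at hW
  have hp₁ (y : ℝ) : HasDerivAt (fun y => a₁ y - a y ^ 3 / (2 * w y))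
      (a₂ y - 3 * a y ^ 2 * a₁ y / (2 * w y) + a y ^ 5 / (2 * w y ^ 2)) y := by
    have := hw0 y
    refine HasDerivAt.congr_deriv ((hA₁ y).sub (((hA₀ y).pow 3).div ((hW y).const_mul 2) (by simpa using this))) ?_
    simp only [Pi.pow_apply]
    field_simp
    ring
  have hp₂ (y : ℝ) : HasDerivAt
      (fun y => a₂ y - 3 * a y ^ 2 * a₁ y / (2 * w y) + a y ^ 5 / (2 * w y ^ 2))
      (a₃ y - (6 * a y * a₁ y ^ 2 + 3 * a y ^ 2 * a₂ y) / (2 * w y)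
        + 4 * a y ^ 4 * a₁ y / w y ^ 2 - a y ^ 7 / w y ^ 3) y := by
    have := hw0 y
    refine HasDerivAt.congr_deriv (((hA₂ y).sub (((((hA₀ y).pow 2).const_mul 3).mul (hA₁ y)).div ((hW y).const_mul 2)
      (by simpa using this))).add (((hA₀ y).pow 5).div (((hW y).pow 2).const_mul 2)
      (by simpa using this))) ?_
    simp only [Pi.pow_apply, Pi.mul_apply]
    field_simp
    ring
  have hp₃ (y : ℝ) : HasDerivAt
      (fun y => a₃ y - (6 * a y * a₁ y ^ 2 + 3 * a y ^ 2 * a₂ y) / (2 * w y)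
        + 4 * a y ^ 4 * a₁ y / w y ^ 2 - a y ^ 7 / w y ^ 3)
      (a₄ y - (6 * a₁ y ^ 3 + 18 * a y * a₁ y * a₂ y + 3 * a y ^ 2 * a₃ y) / (2 * w y)
        + (38 * a y ^ 3 * a₁ y ^ 2 + 11 * a y ^ 4 * a₂ y) / (2 * w y ^ 2)
        - 15 * a y ^ 6 * a₁ y / w y ^ 3 + 3 * a y ^ 9 / w y ^ 4) y := by
    have := hw0 y
    refine HasDerivAt.congr_deriv ((((hA₃ y).sub (((((hA₀ y).const_mul 6).mul ((hA₁ y).pow 2)).add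
      ((((hA₀ y).pow 2).const_mul 3).mul (hA₂ y))).div ((hW y).const_mul 2)
      (by simpa using this))).add (((((hA₀ y).pow 4).const_mul 4).mul (hA₁ y)).div ((hW y).pow 2)
      (by simpa using this))).sub (((hA₀ y).pow 7).div ((hW y).pow 3) (by simpa using this))) ?_
    simp only [Pi.pow_apply, Pi.mul_apply, Pi.add_apply]
    field_simp
    ring
  have hr₁ (y : ℝ) : HasDerivAt (fun y => a y / w y) (a₁ y / w y - a y ^ 3 / w y ^ 2) y := by
    have := hw0 y
    refine HasDerivAt.congr_deriv ((hA₀ y).div (hW y) this) ?_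
    field_simp
  have hr₂ (y : ℝ) : HasDerivAt (fun y => a₁ y / w y - a y ^ 3 / w y ^ 2)
      (a₂ y / w y - 4 * a y ^ 2 * a₁ y / w y ^ 2 + 2 * a y ^ 5 / w y ^ 3) y := by
    have := hw0 y
    refine HasDerivAt.congr_deriv (((hA₁ y).div (hW y) this).sub (((hA₀ y).pow 3).div ((hW y).pow 2)
      (by simpa using this))) ?_
    simp only [Pi.pow_apply]
    field_simp
    ring
  have hr₃ (y : ℝ) : HasDerivAt
      (fun y => a₂ y / w y - 4 * a y ^ 2 * a₁ y / w y ^ 2 + 2 * a y ^ 5 / w y ^ 3)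
      (a₃ y / w y - (5 * a y ^ 2 * a₂ y + 8 * a y * a₁ y ^ 2) / w y ^ 2
        + 18 * a y ^ 4 * a₁ y / w y ^ 3 - 6 * a y ^ 7 / w y ^ 4) y := by
    have := hw0 y
    refine HasDerivAt.congr_deriv ((((hA₂ y).div (hW y) this).sub (((((hA₀ y).pow 2).const_mul 4).mul (hA₁ y)).div
      ((hW y).pow 2) (by simpa using this))).add ((((hA₀ y).pow 5).const_mul 2).div ((hW y).pow 3)
      (by simpa using this))) ?_
    simp only [Pi.pow_apply, Pi.mul_apply]
    field_simp
    ring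
  rw [show iteratedDeriv 3 (fun y => a₁ y - f y t ^ 3 / (2 * Ω y t)) x = _ from
      congrFun (iteratedDeriv_three_eq_of_hasDerivAt hp₁ hp₂ hp₃) x,
    show iteratedDeriv 3 (fun y => f y t / Ω y t) x = _ from
      congrFun (iteratedDeriv_three_eq_of_hasDerivAt hr₁ hr₂ hr₃) x,
    show deriv (fun y => a₁ y - f y t ^ 3 / (2 * Ω y t)) x = _ from (hp₁ x).deriv,
    show deriv (fun y => f y t / Ω y t) x = _ from (hr₁ x).deriv]
  rw [show f x t = a x from rfl, show Ω x t = w x from rfl]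
  have := hw0 x
  constructor
  · simp only [Pi.pow_apply]
    field_simp
    ring
  · field_simp
    ring
end

section
/- Let f, Ω, Λ : ℝ² → ℝ be smooth functions of (x,t) such that ∂f/∂t = ∂³f/∂x³; ∂Ω/∂x = f², ∂Ω/∂t = 2f·f_xx − (f_x)²; ∂Λ/∂x = f·f_xx, ∂Λ/∂t = f·f_xxxx − f_x·f_xxx + (f_xx)²; and Ω is nowhere zero (subscripts denoting partial x-derivatives). Define u := 4f·f_x/Ω − 2f⁴/Ω² (equivalently u = 2·∂²(log|Ω|)/∂x²), q₁ := f_xx − f·Λ/Ω, and q₂ := f/Ω. Then (u, q₁, q₂) satisfies the coupled KdV system: u_t = 3q₂q_{1,xx} + (3/2)u·u_x − 3q₁q_{2,xx} + (1/4)u_xxx; q_{1,t} = q_{1,xxx} + (3/2)u·q_{1,x} + (3/4)u_x·q₁; q_{2,t} = q_{2,xxx} + (3/2)u·q_{2,x} + (3/4)u_x·q₂. -/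
open scoped ContDiff

section PartialDerivatives

variable {g : ℝ → ℝ → ℝ}

theorem hasDerivAt_fst_of_contDiff (hg : ContDiff ℝ ∞ (fun p : ℝ × ℝ => g p.1 p.2)) (x t : ℝ) :
    HasDerivAt (fun y => g y t) (fderiv ℝ (fun p : ℝ × ℝ => g p.1 p.2) (x, t) (1, 0)) x :=
  ((hg.differentiable (by simp)) (x, t)).hasFDerivAt.comp_hasDerivAt (f := fun y => (y, t)) x
    ((hasDerivAt_id x).prodMk (hasDerivAt_const x t))

theorem hasDerivAt_snd_of_contDiff (hg : ContDiff ℝ ∞ (fun p : ℝ × ℝ => g p.1 p.2)) (x t : ℝ) :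
    HasDerivAt (fun s => g x s) (fderiv ℝ (fun p : ℝ × ℝ => g p.1 p.2) (x, t) (0, 1)) t :=
  ((hg.differentiable (by simp)) (x, t)).hasFDerivAt.comp_hasDerivAt t
    ((hasDerivAt_const t x).prodMk (hasDerivAt_id t))

theorem contDiff_fderiv_apply_const (hg : ContDiff ℝ ∞ (fun p : ℝ × ℝ => g p.1 p.2))
    (v : ℝ × ℝ) :
    ContDiff ℝ ∞ (fun p : ℝ × ℝ => fderiv ℝ (fun p : ℝ × ℝ => g p.1 p.2) p v) :=
  (hg.fderiv_right (m := ∞) (by simp)).clm_apply contDiff_const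

theorem contDiff_deriv_fst (hg : ContDiff ℝ ∞ (fun p : ℝ × ℝ => g p.1 p.2)) :
    ContDiff ℝ ∞ (fun p : ℝ × ℝ => deriv (fun y => g y p.2) p.1) := by
  simpa only [(hasDerivAt_fst_of_contDiff hg _ _).deriv] using
    contDiff_fderiv_apply_const hg (1, 0)

/-- Partial derivatives of a smooth function of two real variables commute. -/
theorem deriv_snd_deriv_fst_comm (hg : ContDiff ℝ ∞ (fun p : ℝ × ℝ => g p.1 p.2)) (x t : ℝ) :
    deriv (fun s => deriv (fun y => g y s) x) t = deriv (fun y => deriv (fun s => g y s) t) x := by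
  have hd : DifferentiableAt ℝ (fderiv ℝ (fun p : ℝ × ℝ => g p.1 p.2)) (x, t) :=
    (hg.fderiv_right (m := ∞) (by simp)).differentiable (by simp) _
  have happ (v w : ℝ × ℝ) :
      fderiv ℝ (fun p : ℝ × ℝ => fderiv ℝ (fun p : ℝ × ℝ => g p.1 p.2) p v) (x, t) w
        = fderiv ℝ (fderiv ℝ (fun p : ℝ × ℝ => g p.1 p.2)) (x, t) w v := by
    simp [fderiv_clm_apply hd (differentiableAt_const v)]
  have hsymm : IsSymmSndFDerivAt ℝ (fun p : ℝ × ℝ => g p.1 p.2) (x, t) :=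
    hg.contDiffAt.isSymmSndFDerivAt (by
      simpa using WithTop.coe_le_coe.mpr (le_top : (2 : ℕ∞) ≤ ⊤))
  simp only [(hasDerivAt_fst_of_contDiff hg _ _).deriv, (hasDerivAt_snd_of_contDiff hg _ _).deriv]
  rw [(hasDerivAt_snd_of_contDiff
      (g := fun x t => fderiv ℝ (fun p : ℝ × ℝ => g p.1 p.2) (x, t) (1, 0))
      (contDiff_fderiv_apply_const hg (1, 0)) x t).deriv,
    (hasDerivAt_fst_of_contDiff
      (g := fun x t => fderiv ℝ (fun p : ℝ × ℝ => g p.1 p.2) (x, t) (0, 1))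
      (contDiff_fderiv_apply_const hg (0, 1)) x t).deriv]
  exact (happ _ _).trans ((hsymm.eq _ _).trans (happ _ _).symm)

theorem contDiff_iteratedDeriv_fst (hg : ContDiff ℝ ∞ (fun p : ℝ × ℝ => g p.1 p.2)) (n : ℕ) :
    ContDiff ℝ ∞ (fun p : ℝ × ℝ => iteratedDeriv n (fun y => g y p.2) p.1) := by
  induction n with
  | zero => simpa using hg
  | succ n ih =>
    simpa only [iteratedDeriv_succ] using
      contDiff_deriv_fst (g := fun x t => iteratedDeriv n (fun y => g y t) x) ih

theorem hasDerivAt_iteratedDeriv_fst (hg : ContDiff ℝ ∞ (fun p : ℝ × ℝ => g p.1 p.2))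
    (n : ℕ) (x t : ℝ) :
    HasDerivAt (fun y => iteratedDeriv n (fun y => g y t) y)
      (iteratedDeriv (n + 1) (fun y => g y t) x) x := by
  rw [iteratedDeriv_succ]
  exact (hasDerivAt_fst_of_contDiff
    (g := fun x t => iteratedDeriv n (fun y => g y t) x)
    (contDiff_iteratedDeriv_fst hg n) x t).differentiableAt.hasDerivAt

/-- If `g` solves `g_t = g_xxx`, then so do all its `x`-derivatives. -/
theorem hasDerivAt_iteratedDeriv_of_deriv_eq (hg : ContDiff ℝ ∞ (fun p : ℝ × ℝ => g p.1 p.2))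
    (hgt : ∀ x t, deriv (fun s => g x s) t = iteratedDeriv 3 (fun y => g y t) x)
    (n : ℕ) (x t : ℝ) :
    HasDerivAt (fun s => iteratedDeriv n (fun y => g y s) x)
      (iteratedDeriv (n + 3) (fun y => g y t) x) t := by
  have hderiv (x t : ℝ) : deriv (fun s => iteratedDeriv n (fun y => g y s) x) t
      = iteratedDeriv (n + 3) (fun y => g y t) x := by
    induction n generalizing x t with
    | zero => simpa using hgt x t
    | succ n ih =>
      simp only [iteratedDeriv_succ (n := n)]
      rw [deriv_snd_deriv_fst_comm (g := fun x t => iteratedDeriv n (fun y => g y t) x)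
        (contDiff_iteratedDeriv_fst hg n)]
      simp_rw [ih]
      rw [Nat.add_right_comm n 1 3, iteratedDeriv_succ (n := n + 3)]
  rw [← hderiv]
  exact (hasDerivAt_snd_of_contDiff
    (g := fun x t => iteratedDeriv n (fun y => g y t) x)
    (contDiff_iteratedDeriv_fst hg n) x t).differentiableAt.hasDerivAt

end PartialDerivatives

theorem iteratedDeriv_two_three_of_hasDerivAt {g g₁ g₂ g₃ : ℝ → ℝ}
    (h₁ : ∀ x, HasDerivAt g (g₁ x) x) (h₂ : ∀ x, HasDerivAt g₁ (g₂ x) x)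
    (h₃ : ∀ x, HasDerivAt g₂ (g₃ x) x) :
    deriv g = g₁ ∧ iteratedDeriv 2 g = g₂ ∧ iteratedDeriv 3 g = g₃ := by
  have e₁ : deriv g = g₁ := funext fun x => (h₁ x).deriv
  have e₂ : iteratedDeriv 2 g = g₂ := by
    rw [iteratedDeriv_succ, iteratedDeriv_one, e₁]
    exact funext fun x => (h₂ x).deriv
  refine ⟨e₁, e₂, ?_⟩
  rw [iteratedDeriv_succ, e₂]
  exact funext fun x => (h₃ x).deriv

section JetCalculus

variable {F : ℕ → ℝ → ℝ} {w L : ℝ → ℝ}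

theorem iteratedDeriv_jet_potential
    (hF : ∀ n x, HasDerivAt (F n) (F (n + 1) x) x)
    (hw : ∀ x, HasDerivAt w (-(F 0 x ^ 2 * w x ^ 2)) x) :
    let g : ℝ → ℝ := fun y =>
      -2 * F 0 y ^ 4 * w y ^ 2 + 4 * F 0 y * F 1 y * w y
    deriv g = (fun y =>
      4 * F 0 y ^ 6 * w y ^ 3 - 12 * F 0 y ^ 3 * F 1 y * w y ^ 2 + 4 * F 0 y * F 2 y * w y
      + 4 * F 1 y ^ 2 * w y) ∧
    iteratedDeriv 2 g = (fun y =>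
      -12 * F 0 y ^ 8 * w y ^ 4 + 48 * F 0 y ^ 5 * F 1 y * w y ^ 3
      - 16 * F 0 y ^ 3 * F 2 y * w y ^ 2 - 40 * F 0 y ^ 2 * F 1 y ^ 2 * w y ^ 2
      + 4 * F 0 y * F 3 y * w y + 12 * F 1 y * F 2 y * w y) ∧
    iteratedDeriv 3 g = (fun y =>
      48 * F 0 y ^ 10 * w y ^ 5 - 240 * F 0 y ^ 7 * F 1 y * w y ^ 4
      + 80 * F 0 y ^ 5 * F 2 y * w y ^ 3 + 320 * F 0 y ^ 4 * F 1 y ^ 2 * w y ^ 3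
      - 20 * F 0 y ^ 3 * F 3 y * w y ^ 2 - 140 * F 0 y ^ 2 * F 1 y * F 2 y * w y ^ 2
      - 80 * F 0 y * F 1 y ^ 3 * w y ^ 2 + 4 * F 0 y * F 4 y * w y
      + 16 * F 1 y * F 3 y * w y + 12 * F 2 y ^ 2 * w y) := by
  intro g
  refine iteratedDeriv_two_three_of_hasDerivAt (fun x => ?_) (fun x => ?_) (fun x => ?_)
  · refine HasDerivAt.congr_deriv
      (((((hF 0 x).fun_pow 4).const_mul (-2)).fun_mul ((hw x).fun_pow 2)).fun_add
      ((((hF 0 x).const_mul 4).fun_mul (hF 1 x)).fun_mul (hw x))) ?_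
    ring
  · refine HasDerivAt.congr_deriv
      (((((((hF 0 x).fun_pow 6).const_mul 4).fun_mul ((hw x).fun_pow 3)).fun_sub
      (((((hF 0 x).fun_pow 3).const_mul 12).fun_mul (hF 1 x)).fun_mul
      ((hw x).fun_pow 2))).fun_add ((((hF 0 x).const_mul 4).fun_mul (hF 2 x)).fun_mul
      (hw x))).fun_add ((((hF 1 x).fun_pow 2).const_mul 4).fun_mul (hw x))) ?_
    ring
  · refine HasDerivAt.congr_deriv
      (((((((((hF 0 x).fun_pow 8).const_mul (-12)).fun_mul ((hw x).fun_pow 4)).fun_add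
      (((((hF 0 x).fun_pow 5).const_mul 48).fun_mul (hF 1 x)).fun_mul
      ((hw x).fun_pow 3))).fun_sub (((((hF 0 x).fun_pow 3).const_mul 16).fun_mul
      (hF 2 x)).fun_mul ((hw x).fun_pow 2))).fun_sub
      (((((hF 0 x).fun_pow 2).const_mul 40).fun_mul ((hF 1 x).fun_pow 2)).fun_mul
      ((hw x).fun_pow 2))).fun_add ((((hF 0 x).const_mul 4).fun_mul (hF 3 x)).fun_mul
      (hw x))).fun_add ((((hF 1 x).const_mul 12).fun_mul (hF 2 x)).fun_mul (hw x))) ?_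
    ring

theorem iteratedDeriv_jet_fst
    (hF : ∀ n x, HasDerivAt (F n) (F (n + 1) x) x)
    (hw : ∀ x, HasDerivAt w (-(F 0 x ^ 2 * w x ^ 2)) x)
    (hL : ∀ x, HasDerivAt L (F 0 x * F 2 x) x) :
    let g : ℝ → ℝ := fun y =>
      -F 0 y * w y * L y + F 2 y
    deriv g = (fun y =>
      F 0 y ^ 3 * w y ^ 2 * L y - F 0 y ^ 2 * F 2 y * w y - F 1 y * w y * L y + F 3 y) ∧
    iteratedDeriv 2 g = (fun y =>
      -2 * F 0 y ^ 5 * w y ^ 3 * L y + 2 * F 0 y ^ 4 * F 2 y * w y ^ 2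
      + 4 * F 0 y ^ 2 * F 1 y * w y ^ 2 * L y - F 0 y ^ 2 * F 3 y * w y
      - 3 * F 0 y * F 1 y * F 2 y * w y - F 2 y * w y * L y + F 4 y) ∧
    iteratedDeriv 3 g = (fun y =>
      6 * F 0 y ^ 7 * w y ^ 4 * L y - 6 * F 0 y ^ 6 * F 2 y * w y ^ 3
      - 18 * F 0 y ^ 4 * F 1 y * w y ^ 3 * L y + 3 * F 0 y ^ 4 * F 3 y * w y ^ 2
      + 15 * F 0 y ^ 3 * F 1 y * F 2 y * w y ^ 2 + 5 * F 0 y ^ 2 * F 2 y * w y ^ 2 * L y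
      - F 0 y ^ 2 * F 4 y * w y + 8 * F 0 y * F 1 y ^ 2 * w y ^ 2 * L y
      - 5 * F 0 y * F 1 y * F 3 y * w y - 4 * F 0 y * F 2 y ^ 2 * w y
      - 3 * F 1 y ^ 2 * F 2 y * w y - F 3 y * w y * L y + F 5 y) := by
  intro g
  refine iteratedDeriv_two_three_of_hasDerivAt (fun x => ?_) (fun x => ?_) (fun x => ?_)
  · refine HasDerivAt.congr_deriv
      (((((hF 0 x).fun_neg).fun_mul (hw x)).fun_mul (hL x)).fun_add (hF 2 x)) ?_
    ring
  · refine HasDerivAt.congr_deriv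
      (((((((hF 0 x).fun_pow 3).fun_mul ((hw x).fun_pow 2)).fun_mul (hL x)).fun_sub
      ((((hF 0 x).fun_pow 2).fun_mul (hF 2 x)).fun_mul (hw x))).fun_sub (((hF 1 x).fun_mul
      (hw x)).fun_mul (hL x))).fun_add (hF 3 x)) ?_
    ring
  · refine HasDerivAt.congr_deriv
      (((((((((((hF 0 x).fun_pow 5).const_mul (-2)).fun_mul ((hw x).fun_pow 3)).fun_mul
      (hL x)).fun_add (((((hF 0 x).fun_pow 4).const_mul 2).fun_mul (hF 2 x)).fun_mul
      ((hw x).fun_pow 2))).fun_add ((((((hF 0 x).fun_pow 2).const_mul 4).fun_mul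
      (hF 1 x)).fun_mul ((hw x).fun_pow 2)).fun_mul (hL x))).fun_sub
      ((((hF 0 x).fun_pow 2).fun_mul (hF 3 x)).fun_mul (hw x))).fun_sub
      (((((hF 0 x).const_mul 3).fun_mul (hF 1 x)).fun_mul (hF 2 x)).fun_mul
      (hw x))).fun_sub (((hF 2 x).fun_mul (hw x)).fun_mul (hL x))).fun_add (hF 4 x)) ?_
    ring

theorem iteratedDeriv_jet_snd
    (hF : ∀ n x, HasDerivAt (F n) (F (n + 1) x) x)
    (hw : ∀ x, HasDerivAt w (-(F 0 x ^ 2 * w x ^ 2)) x) :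
    let g : ℝ → ℝ := fun y =>
      F 0 y * w y
    deriv g = (fun y =>
      -F 0 y ^ 3 * w y ^ 2 + F 1 y * w y) ∧
    iteratedDeriv 2 g = (fun y =>
      2 * F 0 y ^ 5 * w y ^ 3 - 4 * F 0 y ^ 2 * F 1 y * w y ^ 2 + F 2 y * w y) ∧
    iteratedDeriv 3 g = (fun y =>
      -6 * F 0 y ^ 7 * w y ^ 4 + 18 * F 0 y ^ 4 * F 1 y * w y ^ 3
      - 5 * F 0 y ^ 2 * F 2 y * w y ^ 2 - 8 * F 0 y * F 1 y ^ 2 * w y ^ 2 + F 3 y * w y) := by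
  intro g
  refine iteratedDeriv_two_three_of_hasDerivAt (fun x => ?_) (fun x => ?_) (fun x => ?_)
  · refine HasDerivAt.congr_deriv
      ((hF 0 x).fun_mul (hw x)) ?_
    ring
  · refine HasDerivAt.congr_deriv
      (((((hF 0 x).fun_pow 3).fun_neg).fun_mul ((hw x).fun_pow 2)).fun_add
      ((hF 1 x).fun_mul (hw x))) ?_
    ring
  · refine HasDerivAt.congr_deriv
      ((((((hF 0 x).fun_pow 5).const_mul 2).fun_mul ((hw x).fun_pow 3)).fun_sub
      (((((hF 0 x).fun_pow 2).const_mul 4).fun_mul (hF 1 x)).fun_mul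
      ((hw x).fun_pow 2))).fun_add ((hF 2 x).fun_mul (hw x))) ?_
    ring

end JetCalculus

/-- The M = 1 instance of Theorem 3.2 for k = 2: if `f_t = f_xxx`, `Ω_x = f²`,
`Ω_t = 2f·f_xx − f_x²`, `Λ_x = f·f_xx`, `Λ_t = f·f_xxxx − f_x·f_xxx + f_xx²`, `Ω ≠ 0`,
then `u = 4f·f_x/Ω − 2f⁴/Ω²`, `q₁ = f_xx − f·Λ/Ω`, `q₂ = f/Ω` solve the coupled KdV
system (the t₃-flow of the (2,1)-constrained CKP hierarchy). -/
theorem stmt_10 (f Ω Λ : ℝ → ℝ → ℝ)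
    (hf : ContDiff ℝ (⊤ : ℕ∞) (fun p : ℝ × ℝ => f p.1 p.2))
    (hΩ : ContDiff ℝ (⊤ : ℕ∞) (fun p : ℝ × ℝ => Ω p.1 p.2))
    (hΛ : ContDiff ℝ (⊤ : ℕ∞) (fun p : ℝ × ℝ => Λ p.1 p.2))
    (hft : ∀ x t, deriv (fun s => f x s) t = iteratedDeriv 3 (fun y => f y t) x)
    (hΩx : ∀ x t, deriv (fun y => Ω y t) x = (f x t) ^ 2)
    (hΩt : ∀ x t, deriv (fun s => Ω x s) t
      = 2 * f x t * iteratedDeriv 2 (fun y => f y t) x - (deriv (fun y => f y t) x) ^ 2)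
    (hΛx : ∀ x t, deriv (fun y => Λ y t) x = f x t * iteratedDeriv 2 (fun y => f y t) x)
    (hΛt : ∀ x t, deriv (fun s => Λ x s) t
      = f x t * iteratedDeriv 4 (fun y => f y t) x
        - deriv (fun y => f y t) x * iteratedDeriv 3 (fun y => f y t) x
        + (iteratedDeriv 2 (fun y => f y t) x) ^ 2)
    (hΩ0 : ∀ x t, Ω x t ≠ 0)
    (u q₁ q₂ : ℝ → ℝ → ℝ)
    (hu : ∀ x t, u x t = 4 * f x t * deriv (fun y => f y t) x / Ω x t
      - 2 * (f x t) ^ 4 / (Ω x t) ^ 2)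
    (hq₁ : ∀ x t, q₁ x t = iteratedDeriv 2 (fun y => f y t) x - f x t * Λ x t / Ω x t)
    (hq₂ : ∀ x t, q₂ x t = f x t / Ω x t) :
    ∀ x t : ℝ,
      deriv (fun s => u x s) t
        = 3 * q₂ x t * iteratedDeriv 2 (fun y => q₁ y t) x
          + (3 / 2) * u x t * deriv (fun y => u y t) x
          - 3 * q₁ x t * iteratedDeriv 2 (fun y => q₂ y t) x
          + (1 / 4) * iteratedDeriv 3 (fun y => u y t) x ∧
      deriv (fun s => q₁ x s) t
        = iteratedDeriv 3 (fun y => q₁ y t) x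
          + (3 / 2) * u x t * deriv (fun y => q₁ y t) x
          + (3 / 4) * deriv (fun y => u y t) x * q₁ x t ∧
      deriv (fun s => q₂ x s) t
        = iteratedDeriv 3 (fun y => q₂ y t) x
          + (3 / 2) * u x t * deriv (fun y => q₂ y t) x
          + (3 / 4) * deriv (fun y => u y t) x * q₂ x t := by
  intro x t
  let F (s : ℝ) (n : ℕ) (y : ℝ) : ℝ := iteratedDeriv n (fun y => f y s) y
  let w (s y : ℝ) : ℝ := (Ω y s)⁻¹
  have hf0 (y s : ℝ) : f y s = F s 0 y := by simp [F]
  have hf1 (y s : ℝ) : deriv (fun y => f y s) y = F s 1 y := by simp [F]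
  have hf2 (y s : ℝ) : iteratedDeriv 2 (fun y => f y s) y = F s 2 y := rfl
  have hFx (n : ℕ) (y : ℝ) : HasDerivAt (F t n) (F t (n + 1) y) y :=
    hasDerivAt_iteratedDeriv_fst hf n y t
  have hFt (n : ℕ) : HasDerivAt (fun s => F s n x) (F t (n + 3) x) t :=
    hasDerivAt_iteratedDeriv_of_deriv_eq hf hft n x t
  have hwx (y : ℝ) : HasDerivAt (w t) (-(F t 0 y ^ 2 * w t y ^ 2)) y := by
    refine ((hasDerivAt_fst_of_contDiff hΩ y t).differentiableAt.hasDerivAt.inv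
      (hΩ0 y t)).congr_deriv ?_
    rw [hΩx, hf0]
    simp only [w]
    ring
  have hwt : HasDerivAt (fun s => w s x)
      (-((2 * F t 0 x * F t 2 x - F t 1 x ^ 2) * w t x ^ 2)) t := by
    refine ((hasDerivAt_snd_of_contDiff hΩ x t).differentiableAt.hasDerivAt.inv
      (hΩ0 x t)).congr_deriv ?_
    rw [hΩt, hf0, hf1, hf2]
    simp only [w]
    ring
  have hLx (y : ℝ) : HasDerivAt (fun y => Λ y t) (F t 0 y * F t 2 y) y := by
    rw [← hf0, ← hf2, ← hΛx]
    exact (hasDerivAt_fst_of_contDiff hΛ y t).differentiableAt.hasDerivAt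
  have hLt : HasDerivAt (fun s => Λ x s)
      (F t 0 x * F t 4 x - F t 1 x * F t 3 x + F t 2 x ^ 2) t := by
    rw [← hf0, ← hf1]
    exact hΛt x t ▸ (hasDerivAt_snd_of_contDiff hΛ x t).differentiableAt.hasDerivAt
  have hu' (y s : ℝ) : u y s = -2 * F s 0 y ^ 4 * w s y ^ 2 + 4 * F s 0 y * F s 1 y * w s y := by
    rw [hu, hf0, hf1]
    simp only [w]
    ring
  have hq₁' (y s : ℝ) : q₁ y s = -F s 0 y * w s y * Λ y s + F s 2 y := by
    rw [hq₁, hf0, hf2]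
    simp only [w]
    ring
  have hq₂' (y s : ℝ) : q₂ y s = F s 0 y * w s y := by
    rw [hq₂, hf0]
    simp only [w]
    ring
  obtain ⟨ux, uxx, uxxx⟩ := iteratedDeriv_jet_potential hFx hwx
  have ut := HasDerivAt.deriv
    (((((hFt 0).fun_pow 4).const_mul (-2)).fun_mul (hwt.fun_pow 2)).fun_add
    ((((hFt 0).const_mul 4).fun_mul (hFt 1)).fun_mul hwt))
  obtain ⟨px, pxx, pxxx⟩ := iteratedDeriv_jet_fst hFx hwx hLx
  have pt := HasDerivAt.deriv
    (((((hFt 0).fun_neg).fun_mul hwt).fun_mul hLt).fun_add (hFt 2))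
  obtain ⟨qx, qxx, qxxx⟩ := iteratedDeriv_jet_snd hFx hwx
  have qt := HasDerivAt.deriv
    ((hFt 0).fun_mul hwt)
  simp only [hu', hq₁', hq₂']
  rw [ux, uxxx, px, pxx, pxxx, qx, qxx, qxxx]
  refine ⟨ut.trans ?_, pt.trans ?_, qt.trans ?_⟩ <;> ring
end

section
/- Define q₁, q₂ : ℝ² → ℝ by q₁(x,t) = (10e^{4x+46t} + 5e^{3x+27t} + e^{5x+53t}) / (25 + 120e^{x+19t} + 150e^{2x+38t} + 15e^{2x+26t} + 40e^{3x+45t} + 3e^{4x+52t}) and q₂(x,t) = 30·(10 + 30e^{x+19t} + 5e^{x+7t} + 24e^{2x+26t} + 10e^{3x+45t} + 3e^{3x+33t} + 2e^{4x+52t}) / (25e^{2x+8t} + 120e^{3x+27t} + 150e^{4x+46t} + 15e^{4x+34t} + 40e^{5x+53t} + 3e^{6x+60t}). Then for all (x,t) ∈ ℝ², ∂q₁/∂t = ∂³q₁/∂x³ + 9q₁q₂·∂q₁/∂x + 3q₁²·∂q₂/∂x and ∂q₂/∂t = ∂³q₂/∂x³ + 9q₁q₂·∂q₂/∂x + 3q₂²·∂q₁/∂x.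 (Note both denominators are everywhere strictly positive.) -/
open Real

/-- The exponential sum `∑ c * exp (a * x + b * t)` over the triples `(c, a, b)` in `L`. -/
noncomputable def expSum (L : List (ℝ × ℝ × ℝ)) (x t : ℝ) : ℝ :=
  (L.map fun p => p.1 * exp (p.2.1 * x + p.2.2 * t)).sum

/-- The coefficient list of the derivative of `expSum L` in its first variable. -/
def expSumDerivX (L : List (ℝ × ℝ × ℝ)) : List (ℝ × ℝ × ℝ) :=
  L.map fun p => (p.1 * p.2.1, p.2)

/-- The coefficient list of the derivative of `expSum L` in its second variable. -/
def expSumDerivT (L : List (ℝ × ℝ × ℝ)) : List (ℝ × ℝ × ℝ) :=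
  L.map fun p => (p.1 * p.2.2, p.2)

theorem hasDerivAt_expSum_fst (L : List (ℝ × ℝ × ℝ)) (x t : ℝ) :
    HasDerivAt (fun y => expSum L y t) (expSum (expSumDerivX L) x t) x := by
  induction L with
  | nil => simpa [expSum, expSumDerivX] using hasDerivAt_const x (0 : ℝ)
  | cons p L ih =>
    have h := ((((hasDerivAt_id x).const_mul p.2.1).add_const (p.2.2 * t)).exp.const_mul p.1).add ih
    refine h.congr_deriv ?_
    simp only [expSum, expSumDerivX, List.map_cons, List.sum_cons, id_eq]
    ring

theorem hasDerivAt_expSum_snd (L : List (ℝ × ℝ × ℝ)) (x t : ℝ) :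
    HasDerivAt (fun s => expSum L x s) (expSum (expSumDerivT L) x t) t := by
  induction L with
  | nil => simpa [expSum, expSumDerivT] using hasDerivAt_const t (0 : ℝ)
  | cons p L ih =>
    have h := ((((hasDerivAt_id t).const_mul p.2.2).const_add (p.2.1 * x)).exp.const_mul p.1).add ih
    refine h.congr_deriv ?_
    simp only [expSum, expSumDerivT, List.map_cons, List.sum_cons, id_eq]
    ring_nf

/-- The third derivative of a quotient, with the denominators cleared. -/
theorem iteratedDeriv_three_div {n n₁ n₂ n₃ d d₁ d₂ d₃ : ℝ → ℝ}
    (hn : ∀ x, HasDerivAt n (n₁ x) x) (hn₁ : ∀ x, HasDerivAt n₁ (n₂ x) x)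
    (hn₂ : ∀ x, HasDerivAt n₂ (n₃ x) x)
    (hd : ∀ x, HasDerivAt d (d₁ x) x) (hd₁ : ∀ x, HasDerivAt d₁ (d₂ x) x)
    (hd₂ : ∀ x, HasDerivAt d₂ (d₃ x) x) (h0 : ∀ x, d x ≠ 0) (x : ℝ) :
    iteratedDeriv 3 (fun y => n y / d y) x =
      (n₃ x * d x ^ 3 - 3 * n₂ x * d₁ x * d x ^ 2 - 3 * n₁ x * d₂ x * d x ^ 2
        + 6 * n₁ x * d₁ x ^ 2 * d x - n x * d₃ x * d x ^ 2 + 6 * n x * d₁ x * d₂ x * d x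
        - 6 * n x * d₁ x ^ 3) / d x ^ 4 := by
  have e₁ : deriv (fun y => n y / d y) = fun y => (n₁ y * d y - n y * d₁ y) / d y ^ 2 :=
    funext fun y => ((hn y).div (hd y) (h0 y)).deriv
  have e₂ : deriv (fun y => (n₁ y * d y - n y * d₁ y) / d y ^ 2) = fun y =>
      (n₂ y * d y ^ 2 - 2 * n₁ y * d₁ y * d y - n y * d₂ y * d y + 2 * n y * d₁ y ^ 2)
        / d y ^ 3 := by
    funext y
    have hy := h0 y
    refine ((((hn₁ y).mul (hd y)).sub ((hn y).mul (hd₁ y))).div ((hd y).pow 2)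
      (pow_ne_zero 2 hy)).deriv.trans ?_
    simp only [Pi.mul_apply, Pi.sub_apply, Pi.pow_apply]
    field_simp
    push_cast
    ring
  rw [iteratedDeriv_succ, iteratedDeriv_succ, iteratedDeriv_one, e₁, e₂]
  have hx := h0 x
  have hnum := (((((hn₂ x).mul ((hd x).pow 2)).sub
      ((((hn₁ x).const_mul 2).mul (hd₁ x)).mul (hd x))).sub
      (((hn x).mul (hd₂ x)).mul (hd x))).add
      (((hn x).const_mul 2).mul ((hd₁ x).pow 2)))
  refine (hnum.div ((hd x).pow 3) (pow_ne_zero 3 hx)).deriv.trans ?_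
  simp only [Pi.mul_apply, Pi.sub_apply, Pi.add_apply, Pi.pow_apply]
  field_simp
  push_cast
  ring

/-- A quotient of exponential sums solves one equation of the constrained CKP `t₃`-flow as soon as
the equation with cleared denominators holds. -/
theorem ckp_flow_of_cleared (N M D : List (ℝ × ℝ × ℝ)) (hD : ∀ x t, expSum D x t ≠ 0) (x t : ℝ)
    (H : ∀ n n₁ n₂ n₃ nₜ m m₁ d d₁ d₂ d₃ dₜ : ℝ,
      n = expSum N x t → n₁ = expSum (expSumDerivX N) x t →
      n₂ = expSum (expSumDerivX (expSumDerivX N)) x t →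
      n₃ = expSum (expSumDerivX (expSumDerivX (expSumDerivX N))) x t →
      nₜ = expSum (expSumDerivT N) x t →
      m = expSum M x t → m₁ = expSum (expSumDerivX M) x t →
      d = expSum D x t → d₁ = expSum (expSumDerivX D) x t →
      d₂ = expSum (expSumDerivX (expSumDerivX D)) x t →
      d₃ = expSum (expSumDerivX (expSumDerivX (expSumDerivX D))) x t →
      dₜ = expSum (expSumDerivT D) x t →
      (nₜ * d - n * dₜ) * d ^ 2 =
        n₃ * d ^ 3 - 3 * n₂ * d₁ * d ^ 2 - 3 * n₁ * d₂ * d ^ 2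
        + 6 * n₁ * d₁ ^ 2 * d - n * d₃ * d ^ 2 + 6 * n * d₁ * d₂ * d - 6 * n * d₁ ^ 3
        + 9 * n * m * (n₁ * d - n * d₁) + 3 * n ^ 2 * (m₁ * d - m * d₁)) :
    deriv (fun s => expSum N x s / expSum D x s) t
      = iteratedDeriv 3 (fun y => expSum N y t / expSum D y t) x
        + 9 * (expSum N x t / expSum D x t) * (expSum M x t / expSum D x t)
          * deriv (fun y => expSum N y t / expSum D y t) x
        + 3 * (expSum N x t / expSum D x t) ^ 2
          * deriv (fun y => expSum M y t / expSum D y t) x := by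
  have hX := fun L y => hasDerivAt_expSum_fst L y t
  rw [iteratedDeriv_three_div (hX N) (hX _) (hX _) (hX D) (hX _) (hX _) (fun y => hD y t),
    ((hX N x).fun_div (hX D x) (hD x t)).deriv, ((hX M x).fun_div (hX D x) (hD x t)).deriv,
    ((hasDerivAt_expSum_snd N x t).fun_div (hasDerivAt_expSum_snd D x t) (hD x t)).deriv]
  have h0 := hD x t
  have key := H _ _ _ _ _ _ _ _ _ _ _ _ rfl rfl rfl rfl rfl rfl rfl rfl rfl rfl rfl rfl
  rw [div_eq_iff (pow_ne_zero 2 h0)]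
  refine mul_right_cancel₀ (pow_ne_zero 2 h0) (key.trans ?_)
  field_simp

/-- Coefficients of the common denominator of the two-soliton solution. -/
def ckpDenom : List (ℝ × ℝ × ℝ) :=
  [(25, 0, 0), (120, 1, 19), (150, 2, 38), (15, 2, 26), (40, 3, 45), (3, 4, 52)]

/-- Coefficients of the numerator of `q₁`. -/
def ckpNumFst : List (ℝ × ℝ × ℝ) :=
  [(10, 4, 46), (5, 3, 27), (1, 5, 53)]

/-- Coefficients of the numerator of `q₂`. -/
def ckpNumSnd : List (ℝ × ℝ × ℝ) :=
  [(300, -2, -8), (900, -1, 11), (150, -1, -1), (720, 0, 18), (300, 1, 37), (90, 1, 25),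
    (60, 2, 44)]

/-- Every phase occurring in the solution is a monomial in `exp (x + 19 * t)`, `exp (x + 7 * t)`
and `exp (± (2 * x + 8 * t))`. -/
theorem exp_phase_eq (x t a b : ℝ) (i j : ℕ) (s : ℝ) (ha : a = s * 2 + i + j)
    (hb : b = s * 8 + 19 * i + 7 * j) :
    exp (a * x + b * t) = exp (s * (2 * x + 8 * t)) * exp (x + 19 * t) ^ i
      * exp (x + 7 * t) ^ j := by
  rw [← exp_nat_mul, ← exp_nat_mul, ← exp_add, ← exp_add, ha, hb]
  ring_nf

theorem expSum_denom_phases (c0 c1 c2 c3 c4 c5 x t : ℝ) :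
    expSum [(c0, 0, 0), (c1, 1, 19), (c2, 2, 38), (c3, 2, 26), (c4, 3, 45), (c5, 4, 52)] x t =
      (c0 * exp (x + 19 * t) ^ 0 * exp (x + 7 * t) ^ 0
        + c1 * exp (x + 19 * t) ^ 1 * exp (x + 7 * t) ^ 0
        + c2 * exp (x + 19 * t) ^ 2 * exp (x + 7 * t) ^ 0
        + c3 * exp (x + 19 * t) ^ 1 * exp (x + 7 * t) ^ 1
        + c4 * exp (x + 19 * t) ^ 2 * exp (x + 7 * t) ^ 1
        + c5 * exp (x + 19 * t) ^ 2 * exp (x + 7 * t) ^ 2) := by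
  simp only [expSum, List.map_cons, List.map_nil, List.sum_cons, List.sum_nil,
    exp_phase_eq x t 0 0 0 0 0 (by norm_num) (by norm_num),
    exp_phase_eq x t 1 19 1 0 0 (by norm_num) (by norm_num),
    exp_phase_eq x t 2 38 2 0 0 (by norm_num) (by norm_num),
    exp_phase_eq x t 2 26 1 1 0 (by norm_num) (by norm_num),
    exp_phase_eq x t 3 45 2 1 0 (by norm_num) (by norm_num),
    exp_phase_eq x t 4 52 2 2 0 (by norm_num) (by norm_num)]
  simp only [zero_mul, exp_zero]
  ring

theorem expSum_numFst_phases (c0 c1 c2 x t : ℝ) :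
    expSum [(c0, 4, 46), (c1, 3, 27), (c2, 5, 53)] x t =
      exp (2 * x + 8 * t) * (c0 * exp (x + 19 * t) ^ 2 * exp (x + 7 * t) ^ 0
        + c1 * exp (x + 19 * t) ^ 1 * exp (x + 7 * t) ^ 0
        + c2 * exp (x + 19 * t) ^ 2 * exp (x + 7 * t) ^ 1) := by
  simp only [expSum, List.map_cons, List.map_nil, List.sum_cons, List.sum_nil,
    exp_phase_eq x t 4 46 2 0 1 (by norm_num) (by norm_num),
    exp_phase_eq x t 3 27 1 0 1 (by norm_num) (by norm_num),
    exp_phase_eq x t 5 53 2 1 1 (by norm_num) (by norm_num)]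
  simp only [one_mul]
  ring

theorem expSum_numSnd_phases (c0 c1 c2 c3 c4 c5 c6 x t : ℝ) :
    expSum [(c0, -2, -8), (c1, -1, 11), (c2, -1, -1), (c3, 0, 18), (c4, 1, 37), (c5, 1, 25),
      (c6, 2, 44)] x t =
      (exp (2 * x + 8 * t))⁻¹ * (c0 * exp (x + 19 * t) ^ 0 * exp (x + 7 * t) ^ 0
        + c1 * exp (x + 19 * t) ^ 1 * exp (x + 7 * t) ^ 0
        + c2 * exp (x + 19 * t) ^ 0 * exp (x + 7 * t) ^ 1
        + c3 * exp (x + 19 * t) ^ 1 * exp (x + 7 * t) ^ 1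
        + c4 * exp (x + 19 * t) ^ 2 * exp (x + 7 * t) ^ 1
        + c5 * exp (x + 19 * t) ^ 1 * exp (x + 7 * t) ^ 2
        + c6 * exp (x + 19 * t) ^ 2 * exp (x + 7 * t) ^ 2) := by
  simp only [expSum, List.map_cons, List.map_nil, List.sum_cons, List.sum_nil,
    exp_phase_eq x t (-2) (-8) 0 0 (-1) (by norm_num) (by norm_num),
    exp_phase_eq x t (-1) 11 1 0 (-1) (by norm_num) (by norm_num),
    exp_phase_eq x t (-1) (-1) 0 1 (-1) (by norm_num) (by norm_num),
    exp_phase_eq x t 0 18 1 1 (-1) (by norm_num) (by norm_num),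
    exp_phase_eq x t 1 37 2 1 (-1) (by norm_num) (by norm_num),
    exp_phase_eq x t 1 25 1 2 (-1) (by norm_num) (by norm_num),
    exp_phase_eq x t 2 44 2 2 (-1) (by norm_num) (by norm_num)]
  simp only [neg_one_mul, exp_neg]
  ring

/-- Example 4.1: an explicit soliton-type solution of the (1,1)-constrained CKP
t₃-flow system, built from the seed `f₁ = e^{x+t} + e^{2x+8t} + e^{3x+27t}`. -/
theorem stmt_11 (q₁ q₂ : ℝ → ℝ → ℝ)
    (hq₁ : ∀ x t, q₁ x t =
      (10 * exp (4 * x + 46 * t) + 5 * exp (3 * x + 27 * t) + exp (5 * x + 53 * t)) /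
      (25 + 120 * exp (x + 19 * t) + 150 * exp (2 * x + 38 * t) + 15 * exp (2 * x + 26 * t)
        + 40 * exp (3 * x + 45 * t) + 3 * exp (4 * x + 52 * t)))
    (hq₂ : ∀ x t, q₂ x t =
      30 * (10 + 30 * exp (x + 19 * t) + 5 * exp (x + 7 * t) + 24 * exp (2 * x + 26 * t)
        + 10 * exp (3 * x + 45 * t) + 3 * exp (3 * x + 33 * t) + 2 * exp (4 * x + 52 * t)) /
      (25 * exp (2 * x + 8 * t) + 120 * exp (3 * x + 27 * t) + 150 * exp (4 * x + 46 * t)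
        + 15 * exp (4 * x + 34 * t) + 40 * exp (5 * x + 53 * t) + 3 * exp (6 * x + 60 * t))) :
    ∀ x t : ℝ,
      deriv (fun s => q₁ x s) t
        = iteratedDeriv 3 (fun y => q₁ y t) x
          + 9 * q₁ x t * q₂ x t * deriv (fun y => q₁ y t) x
          + 3 * (q₁ x t) ^ 2 * deriv (fun y => q₂ y t) x ∧
      deriv (fun s => q₂ x s) t
        = iteratedDeriv 3 (fun y => q₂ y t) x
          + 9 * q₁ x t * q₂ x t * deriv (fun y => q₂ y t) x
          + 3 * (q₂ x t) ^ 2 * deriv (fun y => q₁ y t) x := by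
  intro x t
  have hD : ∀ x t, expSum ckpDenom x t ≠ 0 := fun x t => by
    simp only [expSum, ckpDenom, List.map_cons, List.map_nil, List.sum_cons, List.sum_nil]
    positivity
  have hq₁' : q₁ = fun x t => expSum ckpNumFst x t / expSum ckpDenom x t := by
    funext x t
    rw [hq₁]
    simp [expSum, ckpDenom, ckpNumFst]
    ring_nf
  have hq₂' : q₂ = fun x t => expSum ckpNumSnd x t / expSum ckpDenom x t := by
    funext x t
    have hw := exp_ne_zero (2 * x + 8 * t)
    rw [hq₂, ← mul_div_mul_left _ (expSum ckpDenom x t) hw]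
    simp only [expSum, ckpDenom, ckpNumSnd, List.map_cons, List.map_nil, List.sum_cons,
      List.sum_nil, mul_add, mul_left_comm (exp (2 * x + 8 * t)), ← exp_add]
    ring_nf
    simp
  simp only [hq₁', hq₂']
  constructor
  · refine ckp_flow_of_cleared ckpNumFst ckpNumSnd ckpDenom hD x t ?_
    intro n n₁ n₂ n₃ nₜ m m₁ d d₁ d₂ d₃ dₜ
    simp only [expSumDerivX, expSumDerivT, ckpDenom, ckpNumFst, ckpNumSnd, List.map_cons,
      List.map_nil, expSum_denom_phases, expSum_numFst_phases, expSum_numSnd_phases]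
    generalize exp (x + 19 * t) = u
    generalize exp (x + 7 * t) = v
    have hw := exp_ne_zero (2 * x + 8 * t)
    generalize exp (2 * x + 8 * t) = w at hw ⊢
    rintro rfl rfl rfl rfl rfl rfl rfl rfl rfl rfl rfl rfl
    field_simp
    ring
  · have h := ckp_flow_of_cleared ckpNumSnd ckpNumFst ckpDenom hD x t ?_
    · rw [h]
      ring
    intro n n₁ n₂ n₃ nₜ m m₁ d d₁ d₂ d₃ dₜ
    simp only [expSumDerivX, expSumDerivT, ckpDenom, ckpNumFst, ckpNumSnd, List.map_cons,
      List.map_nil, expSum_denom_phases, expSum_numFst_phases, expSum_numSnd_phases]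
    generalize exp (x + 19 * t) = u
    generalize exp (x + 7 * t) = v
    have hw := exp_ne_zero (2 * x + 8 * t)
    generalize exp (2 * x + 8 * t) = w at hw ⊢
    rintro rfl rfl rfl rfl rfl rfl rfl rfl rfl rfl rfl rfl
    field_simp
    ring
end

section
/- Define, on the open set U = {(x,t) ∈ ℝ² : x ≠ 0 and x⁵ + 320t ≠ 0}, the functions q₁(x,t) = (2/3)·(x⁵ − 480t)/(x⁵ + 320t) and q₂(x,t) = 6·(−x⁵ + 80t)/(x²·(x⁵ + 320t)). Then at every point of U: q_{1,t} = q_{1,xxxxx} + 20q_{1,x}²q_{2,x} + 30q₂q_{1,x}q_{1,xx} + 25q₁q_{2,x}q_{1,xx} + 25q₁q_{1,x}q_{2,xx} + 15q₁q₂q_{1,xxx} + 5q₁²q_{2,xxx} + 80q₁²q₂²q_{1,x} + 40q₁³q₂q_{2,x}, and q_{2,t} = q_{2,xxxxx} + 20q_{2,x}²q_{1,x} + 30q₁q_{2,x}q_{2,xx} + 25q₂q_{1,x}q_{2,xx} + 25q₂q_{2,x}q_{1,xx} + 15q₁q₂q_{2,xxx} + 5q₂²q_{1,xxx} + 80q₁²q₂²q_{2,x}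 + 40q₁q₂³q_{1,x}. -/
open Polynomial in
/-- One differentiation step for functions of the form `P(y⁵) / (yᵃ (y⁵ + c)ᵇ)`: the numerators of
successive derivatives satisfy a first-order differential recursion. -/
theorem eqOn_iteratedDeriv_succ_div {f : ℝ → ℝ} {c : ℝ} {m n : ℕ} {P Q : ℝ[X]}
    (h : ∀ y, y ≠ 0 → y ^ 5 + c ≠ 0 →
      iteratedDeriv n f y = P.eval (y ^ 5) / (y ^ (n + m) * (y ^ 5 + c) ^ (n + 1)))
    (hQ : ∀ z, Q.eval z = 5 * z * (z + c) * (derivative P).eval z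
      - (n + m) * (z + c) * P.eval z - 5 * (n + 1) * z * P.eval z) :
    ∀ y, y ≠ 0 → y ^ 5 + c ≠ 0 →
      iteratedDeriv (n + 1) f y =
        Q.eval (y ^ 5) / (y ^ (n + 1 + m) * (y ^ 5 + c) ^ (n + 1 + 1)) := by
  intro y hy hD
  have hev : iteratedDeriv n f =ᶠ[nhds y]
      fun y => P.eval (y ^ 5) / (y ^ (n + m) * (y ^ 5 + c) ^ (n + 1)) := by
    have h₁ : ∀ᶠ w in nhds y, w ≠ 0 := continuousAt_id.eventually_ne hy
    have h₂ : ∀ᶠ w in nhds y, w ^ 5 + c ≠ 0 :=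
      ContinuousAt.eventually_ne (g := fun w : ℝ => w ^ 5 + c) (by fun_prop) hD
    filter_upwards [h₁, h₂] with w hw₁ hw₂ using h w hw₁ hw₂
  rw [iteratedDeriv_succ, hev.deriv_eq]
  have hP : HasDerivAt (fun y => P.eval (y ^ 5)) ((derivative P).eval (y ^ 5) * (5 * y ^ 4)) y := by
    simpa [Function.comp_def] using (P.hasDerivAt (y ^ 5)).comp y (hasDerivAt_pow 5 y)
  have hE : HasDerivAt (fun y => y ^ 5 + c) (5 * y ^ 4) y := by
    simpa using (hasDerivAt_pow 5 y).add_const c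
  have hx : HasDerivAt (fun y => y ^ (n + m)) ((n + m) * y ^ (n + m) / y) y := by
    refine (hasDerivAt_pow (n + m) y).congr_deriv ?_
    rcases Nat.eq_zero_or_pos (n + m) with h0 | h0
    · have h0' : (n : ℝ) + m = 0 := by exact_mod_cast h0
      simp [h0, h0']
    · obtain ⟨k, hk⟩ := Nat.exists_eq_succ_of_ne_zero h0.ne'
      have hk' : (n : ℝ) + m = k + 1 := by exact_mod_cast hk
      rw [hk, hk']
      simp only [Nat.succ_eq_add_one, Nat.add_sub_cancel, pow_succ]
      push_cast
      field_simp
  have hpow : HasDerivAt (fun y => (y ^ 5 + c) ^ (n + 1))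
      ((n + 1) * (y ^ 5 + c) ^ n * (5 * y ^ 4)) y := by
    simpa using hE.fun_pow (n + 1)
  rw [(hP.fun_div (hx.fun_mul hpow) (by positivity)).deriv, hQ]
  have e : y ^ (n + 1 + m) = y ^ (n + m) * y := by ring
  rw [e]
  simp only [pow_succ _ (n + 1), pow_succ _ n]
  generalize y ^ (n + m) = A at *
  field_simp
  ring

open Polynomial in
/-- Example 4.2: the explicit rational solution `q₁ = (2/3)(x⁵−480t)/(x⁵+320t)`,
`q₂ = 6(−x⁵+80t)/(x²(x⁵+320t))` of the (1,1)-constrained CKP t₅-flow system on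
`U = {(x,t) : x ≠ 0, x⁵ + 320t ≠ 0}`. -/
theorem stmt_12 (q₁ q₂ : ℝ → ℝ → ℝ)
    (hq₁ : ∀ x t, q₁ x t = (2 / 3) * (x ^ 5 - 480 * t) / (x ^ 5 + 320 * t))
    (hq₂ : ∀ x t, q₂ x t = 6 * (-x ^ 5 + 80 * t) / (x ^ 2 * (x ^ 5 + 320 * t))) :
    ∀ x t : ℝ, x ≠ 0 → x ^ 5 + 320 * t ≠ 0 →
      (deriv (fun s => q₁ x s) t
        = iteratedDeriv 5 (fun y => q₁ y t) x
          + 20 * (deriv (fun y => q₁ y t) x) ^ 2 * deriv (fun y => q₂ y t) x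
          + 30 * q₂ x t * deriv (fun y => q₁ y t) x * iteratedDeriv 2 (fun y => q₁ y t) x
          + 25 * q₁ x t * deriv (fun y => q₂ y t) x * iteratedDeriv 2 (fun y => q₁ y t) x
          + 25 * q₁ x t * deriv (fun y => q₁ y t) x * iteratedDeriv 2 (fun y => q₂ y t) x
          + 15 * q₁ x t * q₂ x t * iteratedDeriv 3 (fun y => q₁ y t) x
          + 5 * (q₁ x t) ^ 2 * iteratedDeriv 3 (fun y => q₂ y t) x
          + 80 * (q₁ x t) ^ 2 * (q₂ x t) ^ 2 * deriv (fun y => q₁ y t) x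
          + 40 * (q₁ x t) ^ 3 * q₂ x t * deriv (fun y => q₂ y t) x) ∧
      (deriv (fun s => q₂ x s) t
        = iteratedDeriv 5 (fun y => q₂ y t) x
          + 20 * (deriv (fun y => q₂ y t) x) ^ 2 * deriv (fun y => q₁ y t) x
          + 30 * q₁ x t * deriv (fun y => q₂ y t) x * iteratedDeriv 2 (fun y => q₂ y t) x
          + 25 * q₂ x t * deriv (fun y => q₁ y t) x * iteratedDeriv 2 (fun y => q₂ y t) x
          + 25 * q₂ x t * deriv (fun y => q₂ y t) x * iteratedDeriv 2 (fun y => q₁ y t) x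
          + 15 * q₁ x t * q₂ x t * iteratedDeriv 3 (fun y => q₂ y t) x
          + 5 * (q₂ x t) ^ 2 * iteratedDeriv 3 (fun y => q₁ y t) x
          + 80 * (q₁ x t) ^ 2 * (q₂ x t) ^ 2 * deriv (fun y => q₂ y t) x
          + 40 * q₁ x t * (q₂ x t) ^ 3 * deriv (fun y => q₁ y t) x) := by
  intro x t hx hD
  have q₁d0 : ∀ y, y ≠ 0 → y ^ 5 + 320 * t ≠ 0 → iteratedDeriv 0 (fun y => q₁ y t) y =
      (C ((2/3)) * X + C ((-320) * t) : ℝ[X]).eval (y ^ 5) / (y ^ (0 + 0) * (y ^ 5 + 320 * t) ^ (0 + 1)) := by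
    intro y hy hD
    simp only [iteratedDeriv_zero, hq₁, eval_add, eval_mul, eval_C, eval_X]
    field_simp
    ring
  have q₁d1 : ∀ y, y ≠ 0 → y ^ 5 + 320 * t ≠ 0 → iteratedDeriv 1 (fun y => q₁ y t) y =
      (C ((8000/3) * t) * X : ℝ[X]).eval (y ^ 5) / (y ^ (1 + 0) * (y ^ 5 + 320 * t) ^ (1 + 1)) := by
    refine eqOn_iteratedDeriv_succ_div q₁d0 fun z => ?_
    simp
    ring
  have q₁d2 : ∀ y, y ≠ 0 → y ^ 5 + 320 * t ≠ 0 → iteratedDeriv 2 (fun y => q₁ y t) y =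
      (C ((-16000) * t) * X ^ 2 + C ((10240000/3) * t ^ 2) * X : ℝ[X]).eval (y ^ 5) / (y ^ (2 + 0) * (y ^ 5 + 320 * t) ^ (2 + 1)) := by
    refine eqOn_iteratedDeriv_succ_div q₁d1 fun z => ?_
    simp
    ring
  have q₁d3 : ∀ y, y ≠ 0 → y ^ 5 + 320 * t ≠ 0 → iteratedDeriv 3 (fun y => q₁ y t) y =
      (C ((112000) * t) * X ^ 3 + C ((-81920000) * t ^ 2) * X ^ 2 + C ((3276800000) * t ^ 3) * X : ℝ[X]).eval (y ^ 5) / (y ^ (3 + 0) * (y ^ 5 + 320 * t) ^ (3 + 1)) := by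
    refine eqOn_iteratedDeriv_succ_div q₁d2 fun z => ?_
    simp [derivative_pow]
    ring
  have q₁d4 : ∀ y, y ≠ 0 → y ^ 5 + 320 * t ≠ 0 → iteratedDeriv 4 (fun y => q₁ y t) y =
      (C ((-896000) * t) * X ^ 4 + C ((1495040000) * t ^ 2) * X ^ 3 + C ((-242483200000) * t ^ 3) * X ^ 2 + C ((2097152000000) * t ^ 4) * X : ℝ[X]).eval (y ^ 5) / (y ^ (4 + 0) * (y ^ 5 + 320 * t) ^ (4 + 1)) := by
    refine eqOn_iteratedDeriv_succ_div q₁d3 fun z => ?_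
    simp [derivative_pow]
    ring
  have q₁d5 : ∀ y, y ≠ 0 → y ^ 5 + 320 * t ≠ 0 → iteratedDeriv 5 (fun y => q₁ y t) y =
      (C ((8064000) * t) * X ^ 5 + C ((-25518080000) * t ^ 2) * X ^ 4 + C ((9869721600000) * t ^ 3) * X ^ 3 + C ((-515899392000000) * t ^ 4) * X ^ 2 + C ((671088640000000) * t ^ 5) * X : ℝ[X]).eval (y ^ 5) / (y ^ (5 + 0) * (y ^ 5 + 320 * t) ^ (5 + 1)) := by
    refine eqOn_iteratedDeriv_succ_div q₁d4 fun z => ?_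
    simp [derivative_pow]
    ring
  have q₂d0 : ∀ y, y ≠ 0 → y ^ 5 + 320 * t ≠ 0 → iteratedDeriv 0 (fun y => q₂ y t) y =
      (C ((-6)) * X + C ((480) * t) : ℝ[X]).eval (y ^ 5) / (y ^ (0 + 2) * (y ^ 5 + 320 * t) ^ (0 + 1)) := by
    intro y hy hD
    simp only [iteratedDeriv_zero, hq₂, eval_add, eval_mul, eval_C, eval_X]
    field_simp
    ring
  have q₂d1 : ∀ y, y ≠ 0 → y ^ 5 + 320 * t ≠ 0 → iteratedDeriv 1 (fun y => q₂ y t) y =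
      (C ((12)) * X ^ 2 + C ((-9120) * t) * X + C ((-307200) * t ^ 2) : ℝ[X]).eval (y ^ 5) / (y ^ (1 + 2) * (y ^ 5 + 320 * t) ^ (1 + 1)) := by
    refine eqOn_iteratedDeriv_succ_div q₂d0 fun z => ?_
    simp
    ring
  have q₂d2 : ∀ y, y ≠ 0 → y ^ 5 + 320 * t ≠ 0 → iteratedDeriv 2 (fun y => q₂ y t) y =
      (C ((-36)) * X ^ 3 + C ((99840) * t) * X ^ 2 + C ((-1843200) * t ^ 2) * X + C ((294912000) * t ^ 3) : ℝ[X]).eval (y ^ 5) / (y ^ (2 + 2) * (y ^ 5 + 320 * t) ^ (2 + 1)) := by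
    refine eqOn_iteratedDeriv_succ_div q₂d1 fun z => ?_
    simp [derivative_pow]
    ring
  have q₂d3 : ∀ y, y ≠ 0 → y ^ 5 + 320 * t ≠ 0 → iteratedDeriv 3 (fun y => q₂ y t) y =
      (C ((144)) * X ^ 4 + C ((-1025280) * t) * X ^ 3 + C ((217497600) * t ^ 2) * X ^ 2 + C ((-6193152000) * t ^ 3) * X + C ((-377487360000) * t ^ 4) : ℝ[X]).eval (y ^ 5) / (y ^ (3 + 2) * (y ^ 5 + 320 * t) ^ (3 + 1)) := by
    refine eqOn_iteratedDeriv_succ_div q₂d2 fun z => ?_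
    simp [derivative_pow]
    ring
  have q₂d4 : ∀ y, y ≠ 0 → y ^ 5 + 320 * t ≠ 0 → iteratedDeriv 4 (fun y => q₂ y t) y =
      (C ((-720)) * X ^ 5 + C ((10944000) * t) * X ^ 4 + C ((-6543360000) * t ^ 2) * X ^ 3 + C ((471859200000) * t ^ 3) * X ^ 2 + C ((9437184000000) * t ^ 4) * X + C ((603979776000000) * t ^ 5) : ℝ[X]).eval (y ^ 5) / (y ^ (4 + 2) * (y ^ 5 + 320 * t) ^ (4 + 1)) := by
    refine eqOn_iteratedDeriv_succ_div q₂d3 fun z => ?_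
    simp [derivative_pow]
    ring
  have q₂d5 : ∀ y, y ≠ 0 → y ^ 5 + 320 * t ≠ 0 → iteratedDeriv 5 (fun y => q₂ y t) y =
      (C ((4320)) * X ^ 6 + C ((-124761600) * t) * X ^ 5 + C ((153722880000) * t ^ 2) * X ^ 4 + C ((-28753920000000) * t ^ 3) * X ^ 3 + C ((358612992000000) * t ^ 4) * X ^ 2 + C ((-21743271936000000) * t ^ 5) * X + C ((-1159641169920000000) * t ^ 6) : ℝ[X]).eval (y ^ 5) / (y ^ (5 + 2) * (y ^ 5 + 320 * t) ^ (5 + 1)) := by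
    refine eqOn_iteratedDeriv_succ_div q₂d4 fun z => ?_
    simp [derivative_pow]
    ring
  have hDt : HasDerivAt (fun s => x ^ 5 + 320 * s) 320 t := by
    simpa using ((hasDerivAt_id t).const_mul 320).const_add (x ^ 5)
  have q₁t : deriv (fun s => q₁ x s) t = -(1600 / 3) * x ^ 5 / (x ^ 5 + 320 * t) ^ 2 := by
    have hN : HasDerivAt (fun s => 2 / 3 * (x ^ 5 - 480 * s)) (-320) t := by
      refine ((((hasDerivAt_id t).const_mul 480).const_sub (x ^ 5)).const_mul (2 / 3)).congr_deriv ?_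
      norm_num
    simp only [hq₁]
    rw [(hN.fun_div hDt hD).deriv]
    field_simp
    ring
  have q₂t : deriv (fun s => q₂ x s) t = 2400 * x ^ 3 / (x ^ 5 + 320 * t) ^ 2 := by
    have hN : HasDerivAt (fun s => 6 * (-x ^ 5 + 80 * s)) 480 t := by
      refine ((((hasDerivAt_id t).const_mul 80).const_add (-x ^ 5)).const_mul 6).congr_deriv ?_
      norm_num
    simp only [hq₂]
    rw [(hN.fun_div (hDt.const_mul (x ^ 2)) (mul_ne_zero (pow_ne_zero 2 hx) hD)).deriv]
    field_simp
    ring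
  rw [q₁t, q₂t]
  simp only [← iteratedDeriv_one]
  rw [q₁d1 x hx hD, q₁d2 x hx hD, q₁d3 x hx hD, q₁d5 x hx hD,
    q₂d1 x hx hD, q₂d2 x hx hD, q₂d3 x hx hD, q₂d5 x hx hD, hq₁, hq₂]
  simp only [eval_add, eval_mul, eval_pow, eval_C, eval_X]
  constructor
  · field_simp
    ring
  · field_simp
    ring
end

section
/- Let D(x) = x⁵ − 10x⁴ + 40x³ − 80x² + 80x − 40 and define, on the open set V = {(x,t) ∈ ℝ² : D(x) ≠ 0}, the functions q₁(x,t) = 4·(x⁵ − 10x⁴ + 15tx² + 40x³ − 60tx − 90x² + 60t + 120x − 60)/(3·D(x)), q₂(x,t) = −5·(x² − 4x + 4)/D(x), and u(x,t) = −10x·(x⁷ − 16x⁶ + 112x⁵ − 448x⁴ + 1120x³ − 1760x² + 1600x − 640)/D(x)². Then at every point of V: u_t = 3q₂q_{1,xx} + (3/2)u·u_x − 3q₁q_{2,xx} + (1/4)u_xxx; q_{1,t} = q_{1,xxx} + (3/2)u·q_{1,x} + (3/4)u_x·q₁; and q_{2,t} = q_{2,xxx} + (3/2)u·q_{2,x}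 + (3/4)u_x·q₂. -/
/-- On an open set where `f` agrees with `g₀`, and where each `gᵢ₊₁` is the derivative of `gᵢ`, the
first three iterated derivatives of `f` are `g₁`, `g₂`, `g₃`. -/
theorem iteratedDeriv_eq_of_hasDerivAt_on {U : Set ℝ} (hU : IsOpen U) {f g₀ g₁ g₂ g₃ : ℝ → ℝ}
    (h₀ : ∀ y ∈ U, f y = g₀ y) (h₁ : ∀ y ∈ U, HasDerivAt g₀ (g₁ y) y)
    (h₂ : ∀ y ∈ U, HasDerivAt g₁ (g₂ y) y) (h₃ : ∀ y ∈ U, HasDerivAt g₂ (g₃ y) y)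
    {x : ℝ} (hx : x ∈ U) :
    deriv f x = g₁ x ∧ iteratedDeriv 2 f x = g₂ x ∧ iteratedDeriv 3 f x = g₃ x := by
  have step : ∀ {F G G' : ℝ → ℝ}, (∀ y ∈ U, F y = G y) → (∀ y ∈ U, HasDerivAt G (G' y) y) →
      ∀ y ∈ U, deriv F y = G' y := by
    intro F G G' hFG hG y hy
    have hev : F =ᶠ[nhds y] G := Filter.eventuallyEq_of_mem (hU.mem_nhds hy) hFG
    rw [hev.deriv_eq, (hG y hy).deriv]
  have d₁ := step h₀ h₁
  have d₂ : ∀ y ∈ U, iteratedDeriv 2 f y = g₂ y := by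
    rw [iteratedDeriv_succ, iteratedDeriv_one]
    exact step d₁ h₂
  have d₃ : ∀ y ∈ U, iteratedDeriv 3 f y = g₃ y := by
    rw [iteratedDeriv_succ]
    exact step d₂ h₃
  exact ⟨d₁ x hx, d₂ x hx, d₃ x hx⟩

/-- The derivative of `(y - 2) ^ a / ((y - 2) ^ 5 - 8) ^ n`. -/
theorem hasDerivAt_pow_mul_inv_pow (a n : ℕ) {y : ℝ} (hy : (y - 2) ^ 5 - 8 ≠ 0) :
    HasDerivAt (fun y : ℝ => (y - 2) ^ a * (((y - 2) ^ 5 - 8)⁻¹) ^ n)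
      (a * (y - 2) ^ (a - 1) * (((y - 2) ^ 5 - 8)⁻¹) ^ n
        - 5 * n * (y - 2) ^ (a + 4) * (((y - 2) ^ 5 - 8)⁻¹) ^ (n + 1)) y := by
  have hz : HasDerivAt (fun y : ℝ => y - 2) 1 y := (hasDerivAt_id y).sub_const 2
  have hw : HasDerivAt (fun y : ℝ => ((y - 2) ^ 5 - 8)⁻¹)
      (-(5 * (y - 2) ^ 4) * (((y - 2) ^ 5 - 8)⁻¹) ^ 2) y := by
    refine (((hz.pow 5).sub_const 8).inv hy).congr_deriv ?_
    simp [div_eq_mul_inv]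
  refine ((hz.pow a).mul (hw.pow n)).congr_deriv ?_
  simp only [Pi.pow_apply]
  generalize ((y - 2) ^ 5 - 8)⁻¹ = w
  rcases n with _ | n
  · simp
  · simp only [Nat.add_sub_cancel]
    push_cast
    generalize y - 2 = z
    ring


/-- Example 4.3: the explicit rational solution of the coupled KdV system (the
t₃-flow of the (2,1)-constrained CKP hierarchy), valid where
`D(x) = x⁵ − 10x⁴ + 40x³ − 80x² + 80x − 40 ≠ 0`. -/
theorem stmt_13 (D : ℝ → ℝ)
    (hD : ∀ x, D x = x ^ 5 - 10 * x ^ 4 + 40 * x ^ 3 - 80 * x ^ 2 + 80 * x - 40)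
    (q₁ q₂ u : ℝ → ℝ → ℝ)
    (hq₁ : ∀ x t, q₁ x t =
      4 * (x ^ 5 - 10 * x ^ 4 + 15 * t * x ^ 2 + 40 * x ^ 3 - 60 * t * x - 90 * x ^ 2
        + 60 * t + 120 * x - 60) / (3 * D x))
    (hq₂ : ∀ x t, q₂ x t = -5 * (x ^ 2 - 4 * x + 4) / D x)
    (hu : ∀ x t, u x t =
      -10 * x * (x ^ 7 - 16 * x ^ 6 + 112 * x ^ 5 - 448 * x ^ 4 + 1120 * x ^ 3
        - 1760 * x ^ 2 + 1600 * x - 640) / (D x) ^ 2) :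
    ∀ x t : ℝ, D x ≠ 0 →
      (deriv (fun s => u x s) t
        = 3 * q₂ x t * iteratedDeriv 2 (fun y => q₁ y t) x
          + (3 / 2) * u x t * deriv (fun y => u y t) x
          - 3 * q₁ x t * iteratedDeriv 2 (fun y => q₂ y t) x
          + (1 / 4) * iteratedDeriv 3 (fun y => u y t) x) ∧
      (deriv (fun s => q₁ x s) t
        = iteratedDeriv 3 (fun y => q₁ y t) x
          + (3 / 2) * u x t * deriv (fun y => q₁ y t) x
          + (3 / 4) * deriv (fun y => u y t) x * q₁ x t) ∧
      (deriv (fun s => q₂ x s) t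
        = iteratedDeriv 3 (fun y => q₂ y t) x
          + (3 / 2) * u x t * deriv (fun y => q₂ y t) x
          + (3 / 4) * deriv (fun y => u y t) x * q₂ x t) := by
  intro x t hDx
  have hD' : ∀ x, D x = (x - 2) ^ 5 - 8 := fun x => by rw [hD]; ring
  have hU : IsOpen {y : ℝ | (y - 2) ^ 5 - 8 ≠ 0} :=
    isOpen_ne_fun (by fun_prop) continuous_const
  have hx : x ∈ {y : ℝ | (y - 2) ^ 5 - 8 ≠ 0} := by simpa [hD'] using hDx
  have hx' : (x - 2) ^ 5 - 8 ≠ 0 := hx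
  obtain ⟨du₁, du₂, du₃⟩ := iteratedDeriv_eq_of_hasDerivAt_on hU (f := fun y => u y t)
    (g₀ := fun y =>
      (-10) * ((y - 2) ^ 3 * (((y - 2) ^ 5 - 8)⁻¹) ^ 1) +
      (-400) * ((y - 2) ^ 3 * (((y - 2) ^ 5 - 8)⁻¹) ^ 2))
    (g₁ := fun y =>
      20 * ((y - 2) ^ 2 * (((y - 2) ^ 5 - 8)⁻¹) ^ 1) +
      3200 * ((y - 2) ^ 2 * (((y - 2) ^ 5 - 8)⁻¹) ^ 2) +
      32000 * ((y - 2) ^ 2 * (((y - 2) ^ 5 - 8)⁻¹) ^ 3))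
    (g₂ := fun y =>
      (-60) * ((y - 2) ^ 1 * (((y - 2) ^ 5 - 8)⁻¹) ^ 1) +
      (-26400) * ((y - 2) ^ 1 * (((y - 2) ^ 5 - 8)⁻¹) ^ 2) +
      (-672000) * ((y - 2) ^ 1 * (((y - 2) ^ 5 - 8)⁻¹) ^ 3) +
      (-3840000) * ((y - 2) ^ 1 * (((y - 2) ^ 5 - 8)⁻¹) ^ 4))
    (g₃ := fun y =>
      240 * ((y - 2) ^ 0 * (((y - 2) ^ 5 - 8)⁻¹) ^ 1) +
      240000 * ((y - 2) ^ 0 * (((y - 2) ^ 5 - 8)⁻¹) ^ 2) +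
      11520000 * ((y - 2) ^ 0 * (((y - 2) ^ 5 - 8)⁻¹) ^ 3) +
      153600000 * ((y - 2) ^ 0 * (((y - 2) ^ 5 - 8)⁻¹) ^ 4) +
      614400000 * ((y - 2) ^ 0 * (((y - 2) ^ 5 - 8)⁻¹) ^ 5))
    (fun y (hy : (y - 2) ^ 5 - 8 ≠ 0) => by simp only [hu, hD']; field_simp; ring)
    (fun y (hy : (y - 2) ^ 5 - 8 ≠ 0) => by
      refine HasDerivAt.congr_deriv
        (((hasDerivAt_pow_mul_inv_pow 3 1 hy).const_mul (-10)).add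
        ((hasDerivAt_pow_mul_inv_pow 3 2 hy).const_mul (-400))) ?_
      have hw := inv_mul_cancel₀ hy
      generalize ((y - 2) ^ 5 - 8)⁻¹ = w at hw ⊢
      generalize y - 2 = z at hw ⊢
      push_cast
      linear_combination
        ((-5 * 1 * (-10) * z ^ 2 * w ^ 1) +
        (-5 * 2 * (-400) * z ^ 2 * w ^ 2)) * hw)
    (fun y (hy : (y - 2) ^ 5 - 8 ≠ 0) => by
      refine HasDerivAt.congr_deriv
        ((((hasDerivAt_pow_mul_inv_pow 2 1 hy).const_mul 20).add
        ((hasDerivAt_pow_mul_inv_pow 2 2 hy).const_mul 3200)).add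
        ((hasDerivAt_pow_mul_inv_pow 2 3 hy).const_mul 32000)) ?_
      have hw := inv_mul_cancel₀ hy
      generalize ((y - 2) ^ 5 - 8)⁻¹ = w at hw ⊢
      generalize y - 2 = z at hw ⊢
      push_cast
      linear_combination
        ((-5 * 1 * 20 * z ^ 1 * w ^ 1) +
        (-5 * 2 * 3200 * z ^ 1 * w ^ 2) +
        (-5 * 3 * 32000 * z ^ 1 * w ^ 3)) * hw)
    (fun y (hy : (y - 2) ^ 5 - 8 ≠ 0) => by
      refine HasDerivAt.congr_deriv
        (((((hasDerivAt_pow_mul_inv_pow 1 1 hy).const_mul (-60)).add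
        ((hasDerivAt_pow_mul_inv_pow 1 2 hy).const_mul (-26400))).add
        ((hasDerivAt_pow_mul_inv_pow 1 3 hy).const_mul (-672000))).add
        ((hasDerivAt_pow_mul_inv_pow 1 4 hy).const_mul (-3840000))) ?_
      have hw := inv_mul_cancel₀ hy
      generalize ((y - 2) ^ 5 - 8)⁻¹ = w at hw ⊢
      generalize y - 2 = z at hw ⊢
      push_cast
      linear_combination
        ((-5 * 1 * (-60) * z ^ 0 * w ^ 1) +
        (-5 * 2 * (-26400) * z ^ 0 * w ^ 2) +
        (-5 * 3 * (-672000) * z ^ 0 * w ^ 3) +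
        (-5 * 4 * (-3840000) * z ^ 0 * w ^ 4)) * hw)
    hx
  obtain ⟨dp₁, dp₂, dp₃⟩ := iteratedDeriv_eq_of_hasDerivAt_on hU (f := fun y => q₁ y t)
    (g₀ := fun y =>
      (4 / 3) * ((y - 2) ^ 0 * (((y - 2) ^ 5 - 8)⁻¹) ^ 0) +
      (4 / 3 * 20) * ((y - 2) ^ 0 * (((y - 2) ^ 5 - 8)⁻¹) ^ 1) +
      (20 * t - 40 / 3) * ((y - 2) ^ 2 * (((y - 2) ^ 5 - 8)⁻¹) ^ 1))
    (g₁ := fun y =>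
      (4 / 3 * (-100)) * ((y - 2) ^ 4 * (((y - 2) ^ 5 - 8)⁻¹) ^ 2) +
      ((20 * t - 40 / 3) * (-3)) * ((y - 2) ^ 1 * (((y - 2) ^ 5 - 8)⁻¹) ^ 1) +
      ((20 * t - 40 / 3) * (-40)) * ((y - 2) ^ 1 * (((y - 2) ^ 5 - 8)⁻¹) ^ 2))
    (g₂ := fun y =>
      (4 / 3 * 600) * ((y - 2) ^ 3 * (((y - 2) ^ 5 - 8)⁻¹) ^ 2) +
      (4 / 3 * 8000) * ((y - 2) ^ 3 * (((y - 2) ^ 5 - 8)⁻¹) ^ 3) +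
      ((20 * t - 40 / 3) * 12) * ((y - 2) ^ 0 * (((y - 2) ^ 5 - 8)⁻¹) ^ 1) +
      ((20 * t - 40 / 3) * 480) * ((y - 2) ^ 0 * (((y - 2) ^ 5 - 8)⁻¹) ^ 2) +
      ((20 * t - 40 / 3) * 3200) * ((y - 2) ^ 0 * (((y - 2) ^ 5 - 8)⁻¹) ^ 3))
    (g₃ := fun y =>
      (4 / 3 * (-4200)) * ((y - 2) ^ 2 * (((y - 2) ^ 5 - 8)⁻¹) ^ 2) +
      (4 / 3 * (-144000)) * ((y - 2) ^ 2 * (((y - 2) ^ 5 - 8)⁻¹) ^ 3) +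
      (4 / 3 * (-960000)) * ((y - 2) ^ 2 * (((y - 2) ^ 5 - 8)⁻¹) ^ 4) +
      ((20 * t - 40 / 3) * (-60)) * ((y - 2) ^ 4 * (((y - 2) ^ 5 - 8)⁻¹) ^ 2) +
      ((20 * t - 40 / 3) * (-4800)) * ((y - 2) ^ 4 * (((y - 2) ^ 5 - 8)⁻¹) ^ 3) +
      ((20 * t - 40 / 3) * (-48000)) * ((y - 2) ^ 4 * (((y - 2) ^ 5 - 8)⁻¹) ^ 4))
    (fun y (hy : (y - 2) ^ 5 - 8 ≠ 0) => by simp only [hq₁, hD']; field_simp; ring)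
    (fun y (hy : (y - 2) ^ 5 - 8 ≠ 0) => by
      refine HasDerivAt.congr_deriv
        ((((hasDerivAt_pow_mul_inv_pow 0 0 hy).const_mul (4 / 3)).add
        ((hasDerivAt_pow_mul_inv_pow 0 1 hy).const_mul (4 / 3 * 20))).add
        ((hasDerivAt_pow_mul_inv_pow 2 1 hy).const_mul (20 * t - 40 / 3))) ?_
      have hw := inv_mul_cancel₀ hy
      generalize ((y - 2) ^ 5 - 8)⁻¹ = w at hw ⊢
      generalize y - 2 = z at hw ⊢
      push_cast
      linear_combination ((-5 * 1 * (20 * t - 40 / 3) * z ^ 1 * w ^ 1)) * hw)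
    (fun y (hy : (y - 2) ^ 5 - 8 ≠ 0) => by
      refine HasDerivAt.congr_deriv
        ((((hasDerivAt_pow_mul_inv_pow 4 2 hy).const_mul (4 / 3 * (-100))).add
        ((hasDerivAt_pow_mul_inv_pow 1 1 hy).const_mul ((20 * t - 40 / 3) * (-3)))).add
        ((hasDerivAt_pow_mul_inv_pow 1 2 hy).const_mul ((20 * t - 40 / 3) * (-40)))) ?_
      have hw := inv_mul_cancel₀ hy
      generalize ((y - 2) ^ 5 - 8)⁻¹ = w at hw ⊢
      generalize y - 2 = z at hw ⊢
      push_cast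
      linear_combination
        ((-5 * 2 * (4 / 3 * (-100)) * z ^ 3 * w ^ 2) +
        (-5 * 1 * ((20 * t - 40 / 3) * (-3)) * z ^ 0 * w ^ 1) +
        (-5 * 2 * ((20 * t - 40 / 3) * (-40)) * z ^ 0 * w ^ 2)) * hw)
    (fun y (hy : (y - 2) ^ 5 - 8 ≠ 0) => by
      refine HasDerivAt.congr_deriv
        ((((((hasDerivAt_pow_mul_inv_pow 3 2 hy).const_mul (4 / 3 * 600)).add
        ((hasDerivAt_pow_mul_inv_pow 3 3 hy).const_mul (4 / 3 * 8000))).add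
        ((hasDerivAt_pow_mul_inv_pow 0 1 hy).const_mul ((20 * t - 40 / 3) * 12))).add
        ((hasDerivAt_pow_mul_inv_pow 0 2 hy).const_mul ((20 * t - 40 / 3) * 480))).add
        ((hasDerivAt_pow_mul_inv_pow 0 3 hy).const_mul ((20 * t - 40 / 3) * 3200))) ?_
      have hw := inv_mul_cancel₀ hy
      generalize ((y - 2) ^ 5 - 8)⁻¹ = w at hw ⊢
      generalize y - 2 = z at hw ⊢
      push_cast
      linear_combination
        ((-5 * 2 * (4 / 3 * 600) * z ^ 2 * w ^ 2) +
        (-5 * 3 * (4 / 3 * 8000) * z ^ 2 * w ^ 3)) * hw)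
    hx
  obtain ⟨dq₁, dq₂, dq₃⟩ := iteratedDeriv_eq_of_hasDerivAt_on hU (f := fun y => q₂ y t)
    (g₀ := fun y =>
      (-5) * ((y - 2) ^ 2 * (((y - 2) ^ 5 - 8)⁻¹) ^ 1))
    (g₁ := fun y =>
      15 * ((y - 2) ^ 1 * (((y - 2) ^ 5 - 8)⁻¹) ^ 1) +
      200 * ((y - 2) ^ 1 * (((y - 2) ^ 5 - 8)⁻¹) ^ 2))
    (g₂ := fun y =>
      (-60) * ((y - 2) ^ 0 * (((y - 2) ^ 5 - 8)⁻¹) ^ 1) +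
      (-2400) * ((y - 2) ^ 0 * (((y - 2) ^ 5 - 8)⁻¹) ^ 2) +
      (-16000) * ((y - 2) ^ 0 * (((y - 2) ^ 5 - 8)⁻¹) ^ 3))
    (g₃ := fun y =>
      300 * ((y - 2) ^ 4 * (((y - 2) ^ 5 - 8)⁻¹) ^ 2) +
      24000 * ((y - 2) ^ 4 * (((y - 2) ^ 5 - 8)⁻¹) ^ 3) +
      240000 * ((y - 2) ^ 4 * (((y - 2) ^ 5 - 8)⁻¹) ^ 4))
    (fun y (hy : (y - 2) ^ 5 - 8 ≠ 0) => by simp only [hq₂, hD']; field_simp; ring)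
    (fun y (hy : (y - 2) ^ 5 - 8 ≠ 0) => by
      refine HasDerivAt.congr_deriv
        ((hasDerivAt_pow_mul_inv_pow 2 1 hy).const_mul (-5)) ?_
      have hw := inv_mul_cancel₀ hy
      generalize ((y - 2) ^ 5 - 8)⁻¹ = w at hw ⊢
      generalize y - 2 = z at hw ⊢
      push_cast
      linear_combination ((-5 * 1 * (-5) * z ^ 1 * w ^ 1)) * hw)
    (fun y (hy : (y - 2) ^ 5 - 8 ≠ 0) => by
      refine HasDerivAt.congr_deriv
        (((hasDerivAt_pow_mul_inv_pow 1 1 hy).const_mul 15).add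
        ((hasDerivAt_pow_mul_inv_pow 1 2 hy).const_mul 200)) ?_
      have hw := inv_mul_cancel₀ hy
      generalize ((y - 2) ^ 5 - 8)⁻¹ = w at hw ⊢
      generalize y - 2 = z at hw ⊢
      push_cast
      linear_combination ((-5 * 1 * 15 * z ^ 0 * w ^ 1) + (-5 * 2 * 200 * z ^ 0 * w ^ 2)) * hw)
    (fun y (hy : (y - 2) ^ 5 - 8 ≠ 0) => by
      refine HasDerivAt.congr_deriv
        ((((hasDerivAt_pow_mul_inv_pow 0 1 hy).const_mul (-60)).add
        ((hasDerivAt_pow_mul_inv_pow 0 2 hy).const_mul (-2400))).add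
        ((hasDerivAt_pow_mul_inv_pow 0 3 hy).const_mul (-16000))) ?_
      have hw := inv_mul_cancel₀ hy
      generalize ((y - 2) ^ 5 - 8)⁻¹ = w at hw ⊢
      generalize y - 2 = z at hw ⊢
      push_cast
      ring)
    hx
  have ut : deriv (fun s => u x s) t = 0 := by simp [hu]
  have q₂t : deriv (fun s => q₂ x s) t = 0 := by simp [hq₂]
  have q₁t : deriv (fun s => q₁ x s) t = 20 * (x - 2) ^ 2 / ((x - 2) ^ 5 - 8) := by
    have h : (fun s => q₁ x s) = fun s => 20 * (x - 2) ^ 2 / ((x - 2) ^ 5 - 8) * s + q₁ x 0 := by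
      funext s
      simp only [hq₁, hD']
      field_simp
      ring
    rw [h]
    simp
  rw [ut, q₁t, q₂t, du₁, du₃, dp₁, dp₂, dp₃, dq₁, dq₂, dq₃, hu, hq₁, hq₂, hD']
  obtain ⟨z, rfl⟩ : ∃ z, x = z + 2 := ⟨x - 2, by ring⟩
  simp only [add_sub_cancel_right] at hx' ⊢
  refine ⟨?_, ?_, ?_⟩
  · field_simp
    ring
  · field_simp
    ring
  · field_simp
    ring
end
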